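/- Let (X_1,…,X_n) and (Y_1,…,Y_n) be two samples of independent random variables uniformly distributed on the unit square [0,1]^2. Then there exist absolute constants c, C > 0 such that for every n ≥ 2, c·√(log n / n) ≤ E( inf_σ (1/n) Σ_{k=1}^n |X_k − Y_{σ(k)}| ) ≤ C·√(log n / n), where the infimum runs over all permutations σ of {1,…,n} and |·| is the Euclidean norm on ℝ². (Ajtai–Komlós–Tusnády optimal matching theorem, in expectation.) -/

import Mathlib

open MeasureTheory ProbabilityTheory Real

noncomputable section

/-- Euclidean distance on `ℝ²` (represented as `Fin 2 → ℝ`). -/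
def euclidDist2 (x y : Fin 2 → ℝ) : ℝ := Real.sqrt (∑ i, (x i - y i) ^ 2)

/-- The unit square `[0,1]²`. -/
def unitSquare : Set (Fin 2 → ℝ) := {x | ∀ i, x i ∈ Set.Icc (0 : ℝ) 1}

/-- The uniform probability distribution on the unit square `[0,1]²`. -/
def uniformSquare : Measure (Fin 2 → ℝ) := volume.restrict unitSquare

/-- The optimal matching cost `inf_σ (1/n) Σ_k |x_k − y_{σ(k)}|`. -/
def matchingCost {n : ℕ} (x y : Fin n → (Fin 2 → ℝ)) : ℝ :=
  ⨅ σ : Equiv.Perm (Fin n), (1 / n : ℝ) * ∑ k, euclidDist2 (x k) (y (σ k))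

section

lemma ed_eq (x y : Fin 2 → ℝ) :
    euclidDist2 x y = dist (WithLp.toLp 2 x) (WithLp.toLp 2 y) := by
  rw [EuclideanSpace.dist_eq]
  simp [euclidDist2, Real.dist_eq, sq_abs]

lemma ed_nonneg (x y : Fin 2 → ℝ) : 0 ≤ euclidDist2 x y := Real.sqrt_nonneg _

lemma ed_comm (x y : Fin 2 → ℝ) : euclidDist2 x y = euclidDist2 y x := by
  simp only [ed_eq, dist_comm]

lemma ed_tri (x y z : Fin 2 → ℝ) : euclidDist2 x z ≤ euclidDist2 x y + euclidDist2 y z := by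
  simp only [ed_eq]; exact dist_triangle _ _ _

lemma ed_self (x : Fin 2 → ℝ) : euclidDist2 x x = 0 := by simp [ed_eq]

lemma ed_le (x y : Fin 2 → ℝ) : euclidDist2 x y ≤ |x 0 - y 0| + |x 1 - y 1| := by
  unfold euclidDist2
  rw [Fin.sum_univ_two]
  apply Real.sqrt_le_iff.2
  refine ⟨by positivity, ?_⟩
  nlinarith [sq_abs (x 0 - y 0), sq_abs (x 1 - y 1), abs_nonneg (x 0 - y 0), abs_nonneg (x 1 - y 1),
    mul_nonneg (abs_nonneg (x 0 - y 0)) (abs_nonneg (x 1 - y 1))]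

lemma le_ed (x y : Fin 2 → ℝ) : |x 0 - y 0| + |x 1 - y 1| ≤ 2 * euclidDist2 x y := by
  have h : ∀ i, |x i - y i| ≤ euclidDist2 x y := by
    intro i
    unfold euclidDist2
    apply Real.abs_le_sqrt
    exact Finset.single_le_sum (f := fun i => (x i - y i) ^ 2) (fun i _ => sq_nonneg _) (Finset.mem_univ i)
  linarith [h 0, h 1]

lemma ed_cont : Continuous (fun p : (Fin 2 → ℝ) × (Fin 2 → ℝ) => euclidDist2 p.1 p.2) := by
  unfold euclidDist2; fun_prop

/-- finite assignment duality -/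
lemma assignment_dual {n : ℕ} (hn : 0 < n) (c : Fin n → Fin n → ℝ) (hc : ∀ i j, 0 ≤ c i j) :
    ∃ σ : Equiv.Perm (Fin n), ∃ u v : Fin n → ℝ, (∀ i j, u i + v j ≤ c i j) ∧
      ∑ i, c i (σ i) = ∑ i, u i + ∑ j, v j := by
  classical
  have hne : (Finset.univ : Finset (Fin n)).Nonempty := ⟨⟨0, hn⟩, Finset.mem_univ _⟩
  let V : (Fin n → ℝ) → Fin n → ℝ := fun u j => Finset.univ.inf' hne (fun i => c i j - u i)
  let D : (Fin n → ℝ) → ℝ := fun u => ∑ i, u i + ∑ j, V u j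
  have hVle : ∀ u i j, V u j ≤ c i j - u i := fun u i j =>
    Finset.inf'_le (fun i => c i j - u i) (Finset.mem_univ i)
  have hleV : ∀ u j t, (∀ i, t ≤ c i j - u i) → t ≤ V u j := fun u j t h =>
    Finset.le_inf' _ _ (fun i _ => h i)
  have hVc : ∀ j, Continuous (fun u => V u j) := by
    intro j
    apply Continuous.finset_inf'_apply
    intro i _
    fun_prop
  have hDc : Continuous D := by
    apply Continuous.add
    · fun_prop
    · exact continuous_finsetSum _ (fun j _ => hVc j)
  have hBex : ∃ B, ∀ i j, c i j ≤ B := by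
    refine ⟨∑ i, ∑ j, c i j, fun i j => ?_⟩
    calc c i j ≤ ∑ j, c i j := Finset.single_le_sum (fun j _ => hc i j) (Finset.mem_univ j)
      _ ≤ _ := Finset.single_le_sum (f := fun i => ∑ j, c i j)
        (fun i _ => Finset.sum_nonneg fun j _ => hc i j) (Finset.mem_univ i)
  obtain ⟨B, hB⟩ := hBex
  have hB0 : 0 ≤ B := (hc ⟨0, hn⟩ ⟨0, hn⟩).trans (hB _ _)
  set A : ℝ := n * B with hA
  have hA0 : 0 ≤ A := by positivity
  obtain ⟨us, husK, hus⟩ := (isCompact_Icc (a := fun _ : Fin n => -A) (b := fun _ => (0:ℝ))).exists_isMaxOn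
    ⟨fun _ => 0, ⟨fun _ => by simpa using hA0, fun _ => le_refl _⟩⟩ hDc.continuousOn
  have hmax0 : ∀ u ∈ Set.Icc (fun _ : Fin n => -A) (fun _ => (0:ℝ)), D u ≤ D us := fun u hu => hus hu
  have hD0 : 0 ≤ D us := by
    refine le_trans ?_ (hmax0 (fun _ => 0) ⟨fun _ => by simpa using hA0, fun _ => le_refl _⟩)
    have : 0 ≤ ∑ j, V (fun _ => 0) j := Finset.sum_nonneg fun j _ => hleV _ _ _ (fun i => by simpa using hc i j)
    simpa [D] using this
  have hmax1 : ∀ u : Fin n → ℝ, (∀ i, u i ≤ 0) → (∃ i, u i = 0) → D u ≤ D us := by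
    intro u hu ⟨i₀, hi₀⟩
    by_cases h : ∀ i, -A ≤ u i
    · exact hmax0 u ⟨h, hu⟩
    · push Not at h
      obtain ⟨i₁, hi₁⟩ := h
      refine le_trans ?_ hD0
      have h1 : ∑ i, u i ≤ u i₁ := by
        rw [← Finset.add_sum_erase _ _ (Finset.mem_univ i₁)]
        have : ∑ i ∈ Finset.univ.erase i₁, u i ≤ 0 := Finset.sum_nonpos fun i _ => hu i
        linarith
      have h2 : ∑ j, V u j ≤ ∑ _j : Fin n, B := Finset.sum_le_sum fun j _ => by
        have := hVle u i₀ j; have := hB i₀ j; linarith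
      simp at h2
      simp only [D]; linarith
  have hmax : ∀ u : Fin n → ℝ, D u ≤ D us := by
    intro u
    obtain ⟨i₀, _, hi₀⟩ := Finset.exists_max_image Finset.univ u hne
    have e : D (fun i => u i - u i₀) = D u := by
      have hv : ∀ j, V (fun i => u i - u i₀) j = V u j + u i₀ := by
        intro j
        apply le_antisymm
        · have : V (fun i => u i - u i₀) j - u i₀ ≤ V u j := hleV _ _ _ fun i => by
            have := hVle (fun i => u i - u i₀) i j; linarith
          linarith
        · exact hleV _ _ _ fun i => by have := hVle u i j; linarith
      simp only [D, hv, Finset.sum_sub_distrib, Finset.sum_add_distrib]; ring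
    rw [← e]
    exact hmax1 _ (fun i => by have := hi₀ i (Finset.mem_univ _); linarith) ⟨i₀, by ring⟩
  -- Hall
  let t : Fin n → Finset (Fin n) := fun i => Finset.univ.filter fun j => us i + V us j = c i j
  have hall : ∀ S : Finset (Fin n), S.card ≤ (S.biUnion t).card := by
    intro S
    by_contra hcon
    push Not at hcon
    -- slack
    have hfeas : ∀ i j, us i + V us j ≤ c i j := fun i j => by have := hVle us i j; linarith
    obtain ⟨ε, hε, hεs⟩ : ∃ ε > 0, ∀ i j, us i + V us j ≠ c i j → us i + V us j + ε ≤ c i j := by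
      let T : Finset (Fin n × Fin n) := Finset.univ.filter fun p => us p.1 + V us p.2 ≠ c p.1 p.2
      by_cases hT : T.Nonempty
      · obtain ⟨p, hp, hpm⟩ := Finset.exists_min_image T (fun p => c p.1 p.2 - (us p.1 + V us p.2)) hT
        refine ⟨c p.1 p.2 - (us p.1 + V us p.2), ?_, ?_⟩
        · have := hfeas p.1 p.2
          have h2 : us p.1 + V us p.2 ≠ c p.1 p.2 := (Finset.mem_filter.1 hp).2
          have := lt_of_le_of_ne this h2
          linarith
        · intro i j hij
          have := hpm (i, j) (Finset.mem_filter.2 ⟨Finset.mem_univ _, hij⟩)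
          simp only at this; linarith
      · refine ⟨1, one_pos, fun i j hij => ?_⟩
        exact absurd ⟨(i, j), Finset.mem_filter.2 ⟨Finset.mem_univ _, hij⟩⟩ hT
    let u' : Fin n → ℝ := fun i => us i + if i ∈ S then ε else 0
    let v' : Fin n → ℝ := fun j => V us j - if j ∈ S.biUnion t then ε else 0
    have hf' : ∀ i j, u' i + v' j ≤ c i j := by
      intro i j
      simp only [u', v']
      have h1 := hfeas i j
      by_cases hi : i ∈ S
      · by_cases hj : j ∈ S.biUnion t
        · simp only [hi, hj, if_true]; linarith
        · have : us i + V us j ≠ c i j := fun h => hj (Finset.mem_biUnion.2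
            ⟨i, hi, Finset.mem_filter.2 ⟨Finset.mem_univ _, h⟩⟩)
          have := hεs i j this
          simp only [hi, hj, if_true, if_false]; linarith
      · simp only [hi, if_false]
        split_ifs <;> linarith
    have h1 : ∑ i, u' i + ∑ j, v' j ≤ D u' := by
      simp only [D]
      gcongr with j
      exact hleV _ _ _ fun i => by have := hf' i j; linarith
    have h2 := hmax u'
    have h3 : ∑ i, u' i + ∑ j, v' j = D us + S.card * ε - (S.biUnion t).card * ε := by
      simp only [u', v', D, Finset.sum_add_distrib, Finset.sum_sub_distrib, Finset.sum_ite_mem,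
        Finset.univ_inter, Finset.sum_const, nsmul_eq_mul]
      ring
    have h4 : ((S.biUnion t).card : ℝ) < S.card := by exact_mod_cast hcon
    nlinarith
  obtain ⟨f, hf, hft⟩ := (Finset.all_card_le_biUnion_card_iff_exists_injective t).1 hall
  have hbij : Function.Bijective f := Finite.injective_iff_bijective.1 hf
  refine ⟨Equiv.ofBijective f hbij, us, V us, fun i j => by have := hVle us i j; linarith, ?_⟩
  have : ∀ i, c i (f i) = us i + V us (f i) := fun i => ((Finset.mem_filter.1 (hft i)).2).symm
  simp only [Equiv.ofBijective_apply, this, Finset.sum_add_distrib]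
  congr 1
  exact Equiv.sum_comp (Equiv.ofBijective f hbij) (V us)

lemma mc_le {n : ℕ} (x y : Fin n → (Fin 2 → ℝ)) (σ : Equiv.Perm (Fin n)) :
    matchingCost x y ≤ (1 / n : ℝ) * ∑ k, euclidDist2 (x k) (y (σ k)) :=
  ciInf_le (Set.finite_range _).bddBelow σ

lemma mc_nonneg {n : ℕ} (x y : Fin n → (Fin 2 → ℝ)) : 0 ≤ matchingCost x y :=
  le_ciInf fun σ => mul_nonneg (by positivity) (Finset.sum_nonneg fun k _ => ed_nonneg _ _)

/-- the difficult direction of Kantorovich duality -/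
lemma mc_dual {n : ℕ} (hn : 0 < n) (x y : Fin n → (Fin 2 → ℝ)) :
    ∃ f : (Fin 2 → ℝ) → ℝ, (∀ a b, |f a - f b| ≤ euclidDist2 a b) ∧
      n * matchingCost x y ≤ ∑ k, f (x k) - ∑ k, f (y k) := by
  have hne : (Finset.univ : Finset (Fin n)).Nonempty := ⟨⟨0, hn⟩, Finset.mem_univ _⟩
  obtain ⟨σ, u, v, huv, hs⟩ := assignment_dual hn (fun i j => euclidDist2 (x i) (y j))
    (fun i j => ed_nonneg _ _)
  let f : (Fin 2 → ℝ) → ℝ := fun z => Finset.univ.inf' hne (fun j => euclidDist2 z (y j) - v j)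
  have hle : ∀ z j, f z ≤ euclidDist2 z (y j) - v j := fun z j =>
    Finset.inf'_le (fun j => euclidDist2 z (y j) - v j) (Finset.mem_univ j)
  have hge : ∀ z t, (∀ j, t ≤ euclidDist2 z (y j) - v j) → t ≤ f z := fun z t h =>
    Finset.le_inf' _ _ (fun j _ => h j)
  have h1 : ∀ a b, f a - f b ≤ euclidDist2 a b := by
    intro a b
    have : f a - euclidDist2 a b ≤ f b := hge _ _ fun j => by
      have := hle a j; have := ed_tri a b (y j); linarith
    linarith
  refine ⟨f, fun a b => abs_le.2 ⟨by have := h1 b a; rw [ed_comm] at this; linarith, h1 a b⟩, ?_⟩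
  have hx : ∑ i, u i ≤ ∑ k, f (x k) := Finset.sum_le_sum fun i _ => hge _ _ fun j => by
    have := huv i j; linarith
  have hy : ∑ k, f (y k) ≤ ∑ j, - v j := Finset.sum_le_sum fun j _ => by
    have := hle (y j) j; rw [ed_self] at this; linarith
  rw [Finset.sum_neg_distrib] at hy
  have hm := mc_le x y σ
  have hn' : (0:ℝ) < n := by exact_mod_cast hn
  have : n * matchingCost x y ≤ ∑ k, euclidDist2 (x k) (y (σ k)) := by
    calc n * matchingCost x y ≤ n * ((1 / n : ℝ) * ∑ k, euclidDist2 (x k) (y (σ k))) := by gcongr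
      _ = _ := by field_simp
  linarith

/-- the easy direction -/
lemma mc_ge {n : ℕ} (hn : 0 < n) (x y : Fin n → (Fin 2 → ℝ)) (K : ℝ) (hK : 0 < K)
    (f : (Fin 2 → ℝ) → ℝ) (hf : ∀ a b, f a - f b ≤ K * euclidDist2 a b) :
    ∑ k, f (x k) - ∑ k, f (y k) ≤ K * (n * matchingCost x y) := by
  have hn' : (0:ℝ) < n := by exact_mod_cast hn
  have : (1 / (K * n)) * (∑ k, f (x k) - ∑ k, f (y k)) ≤ matchingCost x y := by
    apply le_ciInf
    intro σ
    have h1 : ∑ k, f (x k) - ∑ k, f (y k) ≤ K * ∑ k, euclidDist2 (x k) (y (σ k)) := by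
      rw [← Equiv.sum_comp σ (fun k => f (y k)), ← Finset.sum_sub_distrib, Finset.mul_sum]
      exact Finset.sum_le_sum fun k _ => hf _ _
    calc _ ≤ (1 / (K * n)) * (K * ∑ k, euclidDist2 (x k) (y (σ k))) := by gcongr
      _ = _ := by field_simp
  calc _ = (K * n) * ((1 / (K * n)) * (∑ k, f (x k) - ∑ k, f (y k))) := by field_simp
    _ ≤ (K * n) * matchingCost x y := by gcongr
    _ = _ := by ring

end

section

lemma unitSquare_eq : unitSquare = Set.Icc (0 : Fin 2 → ℝ) 1 := by
  ext x
  simp only [unitSquare, Set.mem_ofPred_eq, Set.mem_Icc, Pi.le_def, Pi.zero_apply, Pi.one_apply]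
  exact ⟨fun h => ⟨fun i => (h i).1, fun i => (h i).2⟩, fun h i => ⟨h.1 i, h.2 i⟩⟩

lemma unitSquare_meas : MeasurableSet unitSquare := by
  rw [unitSquare_eq]; exact measurableSet_Icc

instance uniformSquare_prob : IsProbabilityMeasure uniformSquare := by
  constructor
  rw [uniformSquare, Measure.restrict_apply_univ, unitSquare_eq, Real.volume_Icc_pi]
  simp

/-- The hypotheses of the theorem, bundled. -/
structure Samp {n : ℕ} {Ω : Type} [MeasurableSpace Ω] (P : Measure Ω)
    (X Y : Fin n → Ω → (Fin 2 → ℝ)) : Prop where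
  prob : IsProbabilityMeasure P
  ind : iIndepFun (Sum.elim X Y) P
  hX : ∀ k, P.map (X k) = uniformSquare
  hY : ∀ k, P.map (Y k) = uniformSquare

variable {n : ℕ} {Ω : Type} [MeasurableSpace Ω] {P : Measure Ω} {X Y : Fin n → Ω → (Fin 2 → ℝ)}

lemma Samp.map (S : Samp P X Y) (s : Fin n ⊕ Fin n) : P.map (Sum.elim X Y s) = uniformSquare := by
  cases s
  · exact S.hX _
  · exact S.hY _

lemma Samp.aem (S : Samp P X Y) (s : Fin n ⊕ Fin n) : AEMeasurable (Sum.elim X Y s) P := by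
  by_contra h
  have h1 := S.map s
  rw [Measure.map_of_not_aemeasurable h] at h1
  have h2 := uniformSquare_prob.measure_univ
  rw [← h1] at h2
  simp at h2

lemma Samp.aemX (S : Samp P X Y) (k : Fin n) : AEMeasurable (X k) P := S.aem (Sum.inl k)
lemma Samp.aemY (S : Samp P X Y) (k : Fin n) : AEMeasurable (Y k) P := S.aem (Sum.inr k)

lemma Samp.ae_mem (S : Samp P X Y) : ∀ᵐ ω ∂P, ∀ k, X k ω ∈ unitSquare ∧ Y k ω ∈ unitSquare := by
  have h0 : ∀ᵐ x ∂uniformSquare, x ∈ unitSquare := ae_restrict_mem unitSquare_meas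
  rw [ae_all_iff]
  intro k
  have h1 : ∀ᵐ ω ∂P, X k ω ∈ unitSquare := by
    rw [← S.hX k] at h0; exact ae_of_ae_map (S.aemX k) h0
  have h2 : ∀ᵐ ω ∂P, Y k ω ∈ unitSquare := by
    rw [← S.hY k] at h0; exact ae_of_ae_map (S.aemY k) h0
  filter_upwards [h1, h2] with ω a b using ⟨a, b⟩

lemma Samp.integrable_mc (S : Samp P X Y) :
    Integrable (fun ω => matchingCost (fun k => X k ω) (fun k => Y k ω)) P := by
  have := S.prob
  have hm : AEMeasurable (fun ω => matchingCost (fun k => X k ω) (fun k => Y k ω)) P := by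
    unfold matchingCost
    refine AEMeasurable.iInf fun σ => ?_
    refine AEMeasurable.const_mul ?_ _
    refine Finset.aemeasurable_fun_sum _ fun k _ => ?_
    unfold euclidDist2
    refine AEMeasurable.sqrt ?_
    refine Finset.aemeasurable_fun_sum _ fun i _ => ?_
    have h1 : AEMeasurable (fun ω => X k ω i) P := (measurable_pi_apply i).comp_aemeasurable (S.aemX k)
    have h2 : AEMeasurable (fun ω => Y (σ k) ω i) P :=
      (measurable_pi_apply i).comp_aemeasurable (S.aemY (σ k))
    exact (h1.sub h2).pow_const 2
  refine Integrable.of_bound hm.aestronglyMeasurable ((1 / n : ℝ) * ∑ _k : Fin n, 2) ?_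
  filter_upwards [S.ae_mem] with ω hω
  rw [Real.norm_of_nonneg (mc_nonneg _ _)]
  refine (mc_le _ _ 1).trans ?_
  gcongr with k
  refine (ed_le _ _).trans ?_
  have hx := (hω k).1
  have hy := (hω k).2
  simp only [Equiv.Perm.coe_one, id]
  have a0 := hx 0; have a1 := hx 1; have b0 := hy 0; have b1 := hy 1
  simp only [Set.mem_Icc] at a0 a1 b0 b1
  have : |X k ω 0 - Y k ω 0| ≤ 1 := abs_le.2 ⟨by linarith, by linarith⟩
  have : |X k ω 1 - Y k ω 1| ≤ 1 := abs_le.2 ⟨by linarith, by linarith⟩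
  linarith

/-- signed sum -/
def Dsum (X Y : Fin n → Ω → (Fin 2 → ℝ)) (φ : (Fin 2 → ℝ) → ℝ) (ω : Ω) : ℝ :=
  ∑ k, φ (X k ω) - ∑ k, φ (Y k ω)

lemma Samp.int_comp (S : Samp P X Y) {E : Type*} [NormedAddCommGroup E] [NormedSpace ℝ E]
    (s : Fin n ⊕ Fin n) (φ : (Fin 2 → ℝ) → E)
    (hφ : AEStronglyMeasurable φ uniformSquare) :
    ∫ ω, φ (Sum.elim X Y s ω) ∂P = ∫ x, φ x ∂uniformSquare := by
  rw [← S.map s, integral_map (S.aem s) (by rw [S.map s]; exact hφ)]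

lemma Samp.D_aem (S : Samp P X Y) {φ : (Fin 2 → ℝ) → ℝ} (hφ : Measurable φ) :
    AEMeasurable (Dsum X Y φ) P := by
  unfold Dsum
  refine AEMeasurable.sub ?_ ?_
  · exact Finset.aemeasurable_fun_sum _ fun k _ => hφ.comp_aemeasurable (S.aemX k)
  · exact Finset.aemeasurable_fun_sum _ fun k _ => hφ.comp_aemeasurable (S.aemY k)

lemma D_bound {φ : (Fin 2 → ℝ) → ℝ} {B : ℝ} (hB : ∀ x, |φ x| ≤ B) (ω : Ω) :
    |Dsum X Y φ ω| ≤ 2 * n * B := by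
  unfold Dsum
  refine (abs_sub _ _).trans ?_
  have h1 : |∑ k, φ (X k ω)| ≤ ∑ _k : Fin n, B :=
    (Finset.abs_sum_le_sum_abs _ _).trans (Finset.sum_le_sum fun k _ => hB _)
  have h2 : |∑ k, φ (Y k ω)| ≤ ∑ _k : Fin n, B :=
    (Finset.abs_sum_le_sum_abs _ _).trans (Finset.sum_le_sum fun k _ => hB _)
  simp at h1 h2
  linarith

lemma Samp.D_memLp (S : Samp P X Y) {φ : (Fin 2 → ℝ) → ℝ} (hφ : Measurable φ) {B : ℝ}
    (hB : ∀ x, |φ x| ≤ B) (p : ENNReal) : MemLp (Dsum X Y φ) p P := by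
  have := S.prob
  exact MemLp.of_bound (S.D_aem hφ).aestronglyMeasurable _ (Filter.Eventually.of_forall fun ω => D_bound hB ω)

lemma Samp.second_moment (S : Samp P X Y) {φ : (Fin 2 → ℝ) → ℝ} (hφ : Measurable φ) {B : ℝ}
    (hB : ∀ x, |φ x| ≤ B) :
    ∫ ω, (Dsum X Y φ ω) ^ 2 ∂P ≤ 2 * n * ∫ x, φ x ^ 2 ∂uniformSquare := by
  have := S.prob
  let g : Fin n ⊕ Fin n → (Fin 2 → ℝ) → ℝ := fun s x => Sum.elim (fun _ => (1:ℝ)) (fun _ => -1) s * φ x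
  have hg : ∀ s, Measurable (g s) := fun s => hφ.const_mul _
  let W : Fin n ⊕ Fin n → Ω → ℝ := fun s => g s ∘ Sum.elim X Y s
  have hWi : iIndepFun W P := S.ind.comp g hg
  have hgB : ∀ s x, |g s x| ≤ B := by
    intro s x
    cases s <;> simp [g, hB x]
  have hWm : ∀ s, AEMeasurable (W s) P := fun s => (hg s).comp_aemeasurable (S.aem s)
  have hWL : ∀ s, MemLp (W s) 2 P := fun s =>
    MemLp.of_bound (hWm s).aestronglyMeasurable B (Filter.Eventually.of_forall fun ω => hgB s _)
  have hWint : ∀ s, Integrable (W s) P := fun s => (hWL s).integrable (by norm_num)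
  have hD : Dsum X Y φ = ∑ s, W s := by
    ext ω
    simp [Dsum, W, g, Finset.sum_apply, Fintype.sum_sum_type, sub_eq_add_neg]
  have hWe : ∀ s, ∫ ω, W s ω ∂P = ∫ x, g s x ∂uniformSquare := fun s =>
    S.int_comp s (g s) (hg s).aestronglyMeasurable
  have hmean : ∫ ω, Dsum X Y φ ω ∂P = 0 := by
    have : Dsum X Y φ = fun ω => ∑ s, W s ω := by rw [hD]; ext ω; simp
    rw [this, integral_finsetSum _ (fun s _ => hWint s), Fintype.sum_sum_type]
    simp only [hWe]
    simp [g, integral_neg]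
  have hvar : variance (Dsum X Y φ) P = ∑ s, variance (W s) P := by
    rw [hD]
    exact IndepFun.variance_sum (fun s _ => hWL s) (fun i _ j _ hij => hWi.indepFun hij)
  have h1 : variance (Dsum X Y φ) P = ∫ ω, (Dsum X Y φ ω) ^ 2 ∂P := by
    rw [variance_of_integral_eq_zero (S.D_aem hφ) hmean]
  rw [← h1, hvar]
  have h2 : ∀ s, variance (W s) P ≤ ∫ x, φ x ^ 2 ∂uniformSquare := by
    intro s
    refine (variance_le_expectation_sq (hWm s).aestronglyMeasurable).trans (le_of_eq ?_)
    have : ∀ ω, (W s ^ 2) ω = (fun x => φ x ^ 2) (Sum.elim X Y s ω) := by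
      intro ω
      cases s <;> simp [W, g]
    simp only [this]
    exact S.int_comp s (fun x => φ x ^ 2) (hφ.pow_const 2).aestronglyMeasurable
  refine (Finset.sum_le_sum fun s _ => h2 s).trans (le_of_eq ?_)
  simp
  left
  ring

lemma Samp.abs_moment (S : Samp P X Y) {φ : (Fin 2 → ℝ) → ℝ} (hφ : Measurable φ) {B V : ℝ}
    (hB : ∀ x, |φ x| ≤ B) (hV : ∫ x, φ x ^ 2 ∂uniformSquare ≤ V) :
    ∫ ω, |Dsum X Y φ ω| ∂P ≤ √(2 * n * V) := by
  have := S.prob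
  apply Real.le_sqrt_of_sq_le
  have h := S.second_moment hφ hB
  have hL : MemLp (fun ω => |Dsum X Y φ ω|) 2 P := (S.D_memLp hφ hB 2).abs
  have h1 := variance_nonneg (fun ω => |Dsum X Y φ ω|) P
  rw [variance_eq_sub hL] at h1
  simp only [Pi.pow_apply, sq_abs] at h1
  have : 2 * n * ∫ x, φ x ^ 2 ∂uniformSquare ≤ 2 * n * V := by gcongr
  linarith

lemma Samp.cos_formula (S : Samp P X Y) {φ : (Fin 2 → ℝ) → ℝ} (hφ : Measurable φ) :
    ∫ ω, Real.cos (Dsum X Y φ ω) ∂P =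
      ((∫ x, Real.cos (φ x) ∂uniformSquare) ^ 2 + (∫ x, Real.sin (φ x) ∂uniformSquare) ^ 2) ^ n := by
  have := S.prob
  let g : Fin n ⊕ Fin n → (Fin 2 → ℝ) → ℂ := fun s x =>
    Complex.exp ((Sum.elim (fun _ => (1:ℝ)) (fun _ => -1) s * φ x : ℝ) * Complex.I)
  have hg : ∀ s, Measurable (g s) := fun s => by
    have : Measurable fun x => Sum.elim (fun _ : Fin n => (1:ℝ)) (fun _ : Fin n => -1) s * φ x := hφ.const_mul _
    exact ((Complex.measurable_ofReal.comp this).mul_const _).cexp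
  have hgn : ∀ s x, ‖g s x‖ ≤ 1 := fun s x => by
    simp only [g]; rw [Complex.norm_exp_ofReal_mul_I]
  have key := S.ind.integral_fun_prod_comp (f := g) S.aem (fun s => by
    rw [S.map s]; exact (hg s).aestronglyMeasurable)
  have hprod : ∀ ω, ∏ s, g s (Sum.elim X Y s ω) = Complex.exp ((Dsum X Y φ ω : ℝ) * Complex.I) := by
    intro ω
    simp only [g]
    rw [← Complex.exp_sum, ← Finset.sum_mul, ← Complex.ofReal_sum]
    congr 3
    simp [Dsum, Fintype.sum_sum_type, sub_eq_add_neg]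
  simp only [hprod] at key
  have hc : Integrable (fun x => Real.cos (φ x)) uniformSquare :=
    Integrable.of_bound (Real.measurable_cos.comp hφ).aestronglyMeasurable 1
      (Filter.Eventually.of_forall fun x => by simpa using Real.abs_cos_le_one (φ x))
  have hs : Integrable (fun x => Real.sin (φ x)) uniformSquare :=
    Integrable.of_bound (Real.measurable_sin.comp hφ).aestronglyMeasurable 1
      (Filter.Eventually.of_forall fun x => by simpa using Real.abs_sin_le_one (φ x))
  set A := ∫ x, Real.cos (φ x) ∂uniformSquare with hA
  set B := ∫ x, Real.sin (φ x) ∂uniformSquare with hB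
  have hgi : ∀ e : ℝ, ∫ x, Complex.exp ((e * φ x : ℝ) * Complex.I) ∂uniformSquare =
      (∫ x, Real.cos (e * φ x) ∂uniformSquare : ℝ) + (∫ x, Real.sin (e * φ x) ∂uniformSquare : ℝ) * Complex.I := by
    intro e
    have hi : Integrable (fun x => Complex.exp ((e * φ x : ℝ) * Complex.I)) uniformSquare := by
      refine Integrable.of_bound ?_ 1 (Filter.Eventually.of_forall fun x => ?_)
      · exact ((Complex.measurable_ofReal.comp (hφ.const_mul e)).mul_const _).cexp.aestronglyMeasurable
      · rw [Complex.norm_exp_ofReal_mul_I]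
    rw [← integral_re_add_im hi]
    simp only [RCLike.re_to_complex, RCLike.im_to_complex, Complex.exp_ofReal_mul_I_re,
      Complex.exp_ofReal_mul_I_im]
    rfl
  have hl : ∀ s, ∫ ω, g s (Sum.elim X Y s ω) ∂P = ∫ x, g s x ∂uniformSquare := fun s =>
    S.int_comp s (g s) (hg s).aestronglyMeasurable
  simp only [hl] at key
  rw [Fintype.prod_sum_type] at key
  simp only [g, Sum.elim_inl, Sum.elim_inr, hgi] at key
  simp only [one_mul, neg_mul, Real.cos_neg, Real.sin_neg, integral_neg, ← hA, ← hB,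
    Finset.prod_const, Finset.card_univ, Fintype.card_fin, ← mul_pow] at key
  have e2 : ((A:ℂ) + B * Complex.I) * (A + ((-B : ℝ) : ℂ) * Complex.I) = ((A ^ 2 + B ^ 2 : ℝ) : ℂ) := by
    push_cast
    ring_nf
    rw [Complex.I_sq]; ring
  rw [e2, ← Complex.ofReal_pow] at key
  have hi : Integrable (fun ω => Complex.exp ((Dsum X Y φ ω : ℝ) * Complex.I)) P := by
    refine Integrable.of_bound ?_ 1 (Filter.Eventually.of_forall fun x => ?_)
    · have := S.D_aem hφ
      exact ((Complex.measurable_exp.comp_aemeasurable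
        ((Complex.measurable_ofReal.comp_aemeasurable this).mul_const _))).aestronglyMeasurable
    · rw [Complex.norm_exp_ofReal_mul_I]
  have h3 := congrArg Complex.re key
  rw [Complex.ofReal_re] at h3
  rw [← h3]
  have h4 := integral_re hi
  simp only [RCLike.re_to_complex, Complex.exp_ofReal_mul_I_re] at h4
  exact h4

lemma cs_bound {φ : (Fin 2 → ℝ) → ℝ} (hφ : Measurable φ) (hB : ∀ x, |φ x| ≤ 1) :
    (∫ x, Real.cos (φ x) ∂uniformSquare) ^ 2 + (∫ x, Real.sin (φ x) ∂uniformSquare) ^ 2 ≤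
    1 - (4 / π ^ 2) * (∫ x, φ x ^ 2 ∂uniformSquare - (∫ x, φ x ∂uniformSquare) ^ 2) := by
  have hc : Integrable (fun x => Real.cos (φ x)) uniformSquare :=
    Integrable.of_bound (Real.measurable_cos.comp hφ).aestronglyMeasurable 1
      (Filter.Eventually.of_forall fun x => by simpa using Real.abs_cos_le_one (φ x))
  have hs : Integrable (fun x => Real.sin (φ x)) uniformSquare :=
    Integrable.of_bound (Real.measurable_sin.comp hφ).aestronglyMeasurable 1
      (Filter.Eventually.of_forall fun x => by simpa using Real.abs_sin_le_one (φ x))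
  have h1 : Integrable φ uniformSquare := Integrable.of_bound hφ.aestronglyMeasurable 1
      (Filter.Eventually.of_forall hB)
  have h2 : Integrable (fun x => φ x ^ 2) uniformSquare :=
    Integrable.of_bound (hφ.pow_const 2).aestronglyMeasurable 1
      (Filter.Eventually.of_forall fun x => by
        have := hB x
        rw [Real.norm_of_nonneg (sq_nonneg _), ← sq_abs]
        have := abs_nonneg (φ x)
        nlinarith)
  set A := ∫ x, Real.cos (φ x) ∂uniformSquare with hA
  set B := ∫ x, Real.sin (φ x) ∂uniformSquare with hB'
  set m := ∫ x, φ x ∂uniformSquare with hm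
  set q := ∫ x, φ x ^ 2 ∂uniformSquare with hq
  set c : ℝ := 2 / π ^ 2 with hcdef
  have hpt : ∀ x y, Real.cos (φ x) * Real.cos (φ y) + Real.sin (φ x) * Real.sin (φ y) ≤
      1 - c * (φ x ^ 2 - 2 * φ x * φ y + φ y ^ 2) := by
    intro x y
    rw [← Real.cos_sub]
    have := Real.cos_le_one_sub_mul_cos_sq (x := φ x - φ y) (by
      have := abs_sub (φ x) (φ y); have := hB x; have := hB y; have := Real.pi_gt_three; linarith)
    calc _ ≤ _ := this
      _ = _ := by ring
  have hin : ∀ y, A * Real.cos (φ y) + B * Real.sin (φ y) ≤ 1 - c * (q - 2 * m * φ y + φ y ^ 2) := by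
    intro y
    have hl : ∫ x, (Real.cos (φ x) * Real.cos (φ y) + Real.sin (φ x) * Real.sin (φ y)) ∂uniformSquare =
        A * Real.cos (φ y) + B * Real.sin (φ y) := by
      rw [integral_add (hc.mul_const _) (hs.mul_const _), integral_mul_const, integral_mul_const]
    have hr : ∫ x, (1 - c * (φ x ^ 2 - 2 * φ x * φ y + φ y ^ 2)) ∂uniformSquare =
        1 - c * (q - 2 * m * φ y + φ y ^ 2) := by
      have i1 : Integrable (fun x => 2 * φ x * φ y) uniformSquare := (h1.const_mul 2).mul_const _
      have i2 : Integrable (fun x => φ x ^ 2 - 2 * φ x * φ y) uniformSquare := h2.sub i1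
      have i3 : Integrable (fun x => φ x ^ 2 - 2 * φ x * φ y + φ y ^ 2) uniformSquare := i2.add (integrable_const _)
      rw [integral_sub (integrable_const _) (i3.const_mul c), integral_const_mul,
        integral_add i2 (integrable_const _), integral_sub h2 i1, integral_mul_const, integral_const_mul]
      simp [← hm, ← hq]
    rw [← hl, ← hr]
    have i1 : Integrable (fun x => 2 * φ x * φ y) uniformSquare := (h1.const_mul 2).mul_const _
    exact integral_mono ((hc.mul_const _).add (hs.mul_const _))
      ((integrable_const _).sub (((h2.sub i1).add (integrable_const _)).const_mul c)) (fun x => hpt x y)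
  have i1 : Integrable (fun y => 2 * m * φ y) uniformSquare := h1.const_mul _
  have i4 : Integrable (fun y => q - 2 * m * φ y) uniformSquare := (integrable_const q).sub i1
  have i5 : Integrable (fun y => q - 2 * m * φ y + φ y ^ 2) uniformSquare := i4.add h2
  have hfin := integral_mono ((hc.const_mul A).add (hs.const_mul B))
    ((integrable_const (1:ℝ)).sub (i5.const_mul c)) hin
  have hl : ∫ y, ((fun y => A * Real.cos (φ y)) + (fun y => B * Real.sin (φ y))) y ∂uniformSquare = A ^ 2 + B ^ 2 := by
    rw [integral_add' (hc.const_mul A) (hs.const_mul B), integral_const_mul, integral_const_mul]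
    ring
  have hr : ∫ y, (1 - c * (q - 2 * m * φ y + φ y ^ 2)) ∂uniformSquare = 1 - (4 / π ^ 2) * (q - m ^ 2) := by
    rw [integral_sub (integrable_const _) (i5.const_mul c), integral_const_mul,
        integral_add i4 h2, integral_sub (integrable_const _) i1, integral_const_mul]
    simp [hcdef, ← hm, ← hq]
    ring
  rw [hl] at hfin
  refine hfin.trans (le_of_eq ?_)
  rw [← hr]; rfl

lemma Samp.abs_lower (S : Samp P X Y) {φ : (Fin 2 → ℝ) → ℝ} (hφ : Measurable φ) {s κ : ℝ} (hs : 0 < s)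
    (hB : ∀ x, |φ x| ≤ s) (hn : 0 < n)
    (hvar : κ * s ^ 2 / n ≤ ∫ x, φ x ^ 2 ∂uniformSquare - (∫ x, φ x ∂uniformSquare) ^ 2) :
    s * (1 - Real.exp (-(4 / π ^ 2 * κ))) ≤ ∫ ω, |Dsum X Y φ ω| ∂P := by
  have := S.prob
  have hn' : (0:ℝ) < n := by exact_mod_cast hn
  let ψ : (Fin 2 → ℝ) → ℝ := fun x => φ x / s
  have hψ : Measurable ψ := hφ.div_const s
  have hψB : ∀ x, |ψ x| ≤ 1 := fun x => by
    simp only [ψ, abs_div, abs_of_pos hs]; exact (div_le_one hs).2 (hB x)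
  have h1 := cs_bound hψ hψB
  have h2 := S.cos_formula hψ
  have e1 : ∫ x, ψ x ^ 2 ∂uniformSquare - (∫ x, ψ x ∂uniformSquare) ^ 2 =
      (∫ x, φ x ^ 2 ∂uniformSquare - (∫ x, φ x ∂uniformSquare) ^ 2) / s ^ 2 := by
    simp only [ψ, div_pow, integral_div]; ring
  have h3 : κ / n ≤ ∫ x, ψ x ^ 2 ∂uniformSquare - (∫ x, ψ x ∂uniformSquare) ^ 2 := by
    rw [e1, le_div_iff₀ (by positivity)]
    refine le_trans (le_of_eq ?_) hvar; ring
  have h4 : ∫ ω, Real.cos (Dsum X Y ψ ω) ∂P ≤ Real.exp (-(4 / π ^ 2 * κ)) := by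
    rw [h2]
    have h5 : (∫ x, Real.cos (ψ x) ∂uniformSquare) ^ 2 + (∫ x, Real.sin (ψ x) ∂uniformSquare) ^ 2 ≤
        Real.exp (-(4 / π ^ 2 * κ) / n) := by
      refine h1.trans ?_
      have h6 := Real.add_one_le_exp (-(4 / π ^ 2 * κ) / n)
      have h7 : (4 / π ^ 2) * (κ / n) ≤ (4 / π ^ 2) * (∫ x, ψ x ^ 2 ∂uniformSquare - (∫ x, ψ x ∂uniformSquare) ^ 2) := by
        gcongr
      have h8 : -(4 / π ^ 2 * κ) / n = - ((4 / π ^ 2) * (κ / n)) := by ring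
      linarith
    calc _ ≤ (Real.exp (-(4 / π ^ 2 * κ) / n)) ^ n := by gcongr
      _ = _ := by rw [← Real.exp_nat_mul]; congr 1; field_simp
  have hD : ∀ ω, Dsum X Y ψ ω = Dsum X Y φ ω / s := by
    intro ω; simp only [Dsum, ψ, ← Finset.sum_div]; ring
  have hpt : ∀ t : ℝ, 1 - Real.cos t ≤ |t| := by
    intro t
    have a := Real.abs_cos_sub_cos_le 0 t
    rw [Real.cos_zero, zero_sub, abs_neg] at a
    exact (le_abs_self _).trans a
  have hi1 : Integrable (fun ω => Real.cos (Dsum X Y ψ ω)) P :=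
    Integrable.of_bound (Real.measurable_cos.comp_aemeasurable (S.D_aem hψ)).aestronglyMeasurable 1
      (Filter.Eventually.of_forall fun x => by simpa using Real.abs_cos_le_one _)
  have hi2 : Integrable (fun ω => |Dsum X Y φ ω|) P :=
    ((S.D_memLp hφ hB 1).integrable le_rfl).abs
  have h9 : ∫ ω, s * (1 - Real.cos (Dsum X Y ψ ω)) ∂P ≤ ∫ ω, |Dsum X Y φ ω| ∂P := by
    refine integral_mono (((integrable_const _).sub hi1).const_mul s) hi2 fun ω => ?_
    have := hpt (Dsum X Y ψ ω)
    have e : |Dsum X Y φ ω| = s * |Dsum X Y ψ ω| := by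
      rw [hD, abs_div, abs_of_pos hs]; field_simp
    simp only [e]
    gcongr
  rw [integral_const_mul, integral_sub (integrable_const _) hi1] at h9
  simp only [integral_const, probReal_univ, smul_eq_mul, mul_one] at h9
  refine le_trans ?_ h9
  gcongr
end

section

/-- dyadic block weights -/
def mw (i a c : ℕ) : ℝ := if c / 2 ^ i = a / 2 ^ i then ((2:ℝ) ^ i)⁻¹ else 0

/-- difference of the distribution functions of consecutive block weights -/
def kap (i a b : ℕ) : ℝ :=
  ∑ c ∈ Finset.range (b + 1), mw (i + 1) a c - ∑ c ∈ Finset.range (b + 1), mw i a c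

lemma mw_nonneg (i a c : ℕ) : 0 ≤ mw i a c := by
  unfold mw; split_ifs <;> positivity

lemma mw_le (i a c : ℕ) : mw i a c ≤ ((2:ℝ) ^ i)⁻¹ := by
  unfold mw; split_ifs
  · exact le_rfl
  · positivity

lemma block_iff (i a c : ℕ) : c / 2 ^ i = a / 2 ^ i ↔
    c ∈ Finset.Ico (a / 2 ^ i * 2 ^ i) (a / 2 ^ i * 2 ^ i + 2 ^ i) := by
  rw [Finset.mem_Ico, Nat.div_eq_iff (by positivity)]
  have : 0 < 2 ^ i := by positivity
  constructor
  · rintro ⟨h1, h2⟩; constructor <;> omega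
  · rintro ⟨h1, h2⟩; constructor <;> omega

lemma mw_sum_eq (i a K : ℕ) (h : a / 2 ^ i * 2 ^ i + 2 ^ i ≤ K) :
    ∑ c ∈ Finset.range K, mw i a c = 1 := by
  unfold mw
  rw [← Finset.sum_filter, Finset.sum_const, nsmul_eq_mul]
  have : Finset.filter (fun c => c / 2 ^ i = a / 2 ^ i) (Finset.range K) =
      Finset.Ico (a / 2 ^ i * 2 ^ i) (a / 2 ^ i * 2 ^ i + 2 ^ i) := by
    ext c
    rw [Finset.mem_filter, block_iff, Finset.mem_range]
    constructor
    · exact fun h => h.2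
    · intro h'
      refine ⟨?_, h'⟩
      have := (Finset.mem_Ico.1 h').2
      omega
  rw [this, Nat.card_Ico]
  simp

lemma mw_sum_le (i a K : ℕ) : ∑ c ∈ Finset.range K, mw i a c ≤ 1 := by
  rw [← mw_sum_eq i a (max K (a / 2 ^ i * 2 ^ i + 2 ^ i)) (le_max_right _ _)]
  exact Finset.sum_le_sum_of_subset_of_nonneg (Finset.range_mono (le_max_left _ _))
    (fun c _ _ => mw_nonneg _ _ _)

lemma mw_sum_zero (i a K : ℕ) (h : K ≤ a / 2 ^ i * 2 ^ i) :
    ∑ c ∈ Finset.range K, mw i a c = 0 := by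
  apply Finset.sum_eq_zero
  intro c hc
  unfold mw
  rw [if_neg]
  rw [block_iff, Finset.mem_Ico]
  have := Finset.mem_range.1 hc
  omega

lemma mw_sum_N {L i a : ℕ} (hi : i ≤ L) (ha : a < 2 ^ L) :
    ∑ c ∈ Finset.range (2 ^ L), mw i a c = 1 := by
  apply mw_sum_eq
  obtain ⟨k, rfl⟩ := Nat.exists_eq_add_of_le hi
  have h2 : a / 2 ^ i < 2 ^ k := by
    rw [Nat.div_lt_iff_lt_mul (by positivity), ← pow_add, add_comm k i]; exact ha
  calc a / 2 ^ i * 2 ^ i + 2 ^ i = (a / 2 ^ i + 1) * 2 ^ i := by ring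
    _ ≤ 2 ^ k * 2 ^ i := Nat.mul_le_mul_right _ h2
    _ = _ := by rw [← pow_add, add_comm k i]

lemma kap_abs (i a b : ℕ) : |kap i a b| ≤ if a / 2 ^ (i + 1) = b / 2 ^ (i + 1) then 1 else 0 := by
  split_ifs with h
  · unfold kap
    have h1 := mw_sum_le (i + 1) a (b + 1)
    have h2 := mw_sum_le i a (b + 1)
    have h3 : 0 ≤ ∑ c ∈ Finset.range (b + 1), mw (i + 1) a c := Finset.sum_nonneg fun c _ => mw_nonneg _ _ _
    have h4 : 0 ≤ ∑ c ∈ Finset.range (b + 1), mw i a c := Finset.sum_nonneg fun c _ => mw_nonneg _ _ _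
    rw [abs_le]; constructor <;> linarith
  · suffices kap i a b = 0 by simp [this]
    unfold kap
    have hp : 2 ^ (i + 1) = 2 * 2 ^ i := by ring
    have hpos : 0 < 2 ^ i := by positivity
    set p := 2 ^ i with hpdef
    have e1 : a / (2 * p) = a / p / 2 := by rw [Nat.mul_comm, Nat.div_div_eq_div_mul]
    have e3 := Nat.div_add_mod (a / p) 2
    have e4 := Nat.mod_lt (a / p) (by norm_num : 0 < 2)
    rw [hp] at h
    have f1 := Nat.div_add_mod b (2 * p)
    have f2 := Nat.mod_lt b (by omega : 0 < 2 * p)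
    rcases lt_or_gt_of_ne h with h | h
    · have hm : (a / (2 * p) + 1) * (2 * p) ≤ b / (2 * p) * (2 * p) := Nat.mul_le_mul_right _ h
      rw [mw_sum_eq, mw_sum_eq, sub_self]
      · rw [← hpdef]
        have : (a / p + 1) * p ≤ (a / (2 * p) + 1) * (2 * p) := by
          rw [e1]
          calc (a / p + 1) * p ≤ (2 * (a / p / 2) + 2) * p := Nat.mul_le_mul_right _ (by omega)
            _ = _ := by ring
        have hb := Nat.div_mul_le_self b (2 * p)
        have e9 : a / p * p + p = (a / p + 1) * p := by ring
        omega
      · rw [hp]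
        have hb := Nat.div_mul_le_self b (2 * p)
        have e9 : a / (2 * p) * (2 * p) + 2 * p = (a / (2 * p) + 1) * (2 * p) := by ring
        omega
    · have hm : (b / (2 * p) + 1) * (2 * p) ≤ a / (2 * p) * (2 * p) := Nat.mul_le_mul_right _ h
      rw [mw_sum_zero, mw_sum_zero, sub_self]
      · rw [← hpdef]
        have : a / (2 * p) * (2 * p) ≤ a / p * p := by
          rw [e1]
          calc a / p / 2 * (2 * p) = (2 * (a / p / 2)) * p := by ring
            _ ≤ _ := Nat.mul_le_mul_right _ (by omega)
        nlinarith
      · rw [hp]; nlinarith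

lemma abel_sum (w v : ℕ → ℝ) (N : ℕ) :
    ∑ c ∈ Finset.range N, w c * v c = (∑ c ∈ Finset.range N, w c) * v N
      - ∑ b ∈ Finset.range N, (∑ c ∈ Finset.range (b + 1), w c) * (v (b + 1) - v b) := by
  induction N with
  | zero => simp
  | succ N ih => rw [Finset.sum_range_succ, ih, Finset.sum_range_succ (fun b => _ * _), Finset.sum_range_succ w]; ring

lemma kap_sum {L i a : ℕ} (hi : i < L) (ha : a < 2 ^ L) (v : ℕ → ℝ) :
    ∑ c ∈ Finset.range (2 ^ L), mw i a c * v c - ∑ c ∈ Finset.range (2 ^ L), mw (i + 1) a c * v c =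
    ∑ b ∈ Finset.range (2 ^ L), kap i a b * (v (b + 1) - v b) := by
  rw [abel_sum (mw i a) v, abel_sum (mw (i + 1) a) v, mw_sum_N hi.le ha, mw_sum_N (i := i + 1) hi ha]
  simp only [kap, sub_mul (_ : ℝ), Finset.sum_sub_distrib]
  ring

def Aavg (L i : ℕ) (u : ℕ → ℕ → ℝ) (a₁ a₂ : ℕ) : ℝ :=
  ∑ c₁ ∈ Finset.range (2 ^ L), ∑ c₂ ∈ Finset.range (2 ^ L), mw i a₁ c₁ * mw i a₂ c₂ * u c₁ c₂

def K1 (L a₁ a₂ b₁ b₂ : ℕ) : ℝ := ∑ i ∈ Finset.range L, kap i a₁ b₁ * mw i a₂ b₂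
def K2 (L a₁ a₂ b₁ b₂ : ℕ) : ℝ := ∑ i ∈ Finset.range L, mw (i + 1) a₁ b₁ * kap i a₂ b₂

def tind (i a₁ a₂ b₁ b₂ : ℕ) : ℝ :=
  if a₁ / 2 ^ (i + 1) = b₁ / 2 ^ (i + 1) ∧ a₂ / 2 ^ (i + 1) = b₂ / 2 ^ (i + 1) then 1 else 0

def Phi (L a₁ a₂ b₁ b₂ : ℕ) : ℝ := ∑ i ∈ Finset.range L, (1 / 2 : ℝ) ^ i * tind i a₁ a₂ b₁ b₂

lemma div_succ_of_div {i a b : ℕ} (h : b / 2 ^ i = a / 2 ^ i) : a / 2 ^ (i + 1) = b / 2 ^ (i + 1) := by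
  rw [pow_succ, ← Nat.div_div_eq_div_mul, ← Nat.div_div_eq_div_mul, h]

lemma K1_le (L a₁ a₂ b₁ b₂ : ℕ) : |K1 L a₁ a₂ b₁ b₂| ≤ Phi L a₁ a₂ b₁ b₂ := by
  unfold K1 Phi
  refine (Finset.abs_sum_le_sum_abs _ _).trans (Finset.sum_le_sum fun i _ => ?_)
  rw [abs_mul, abs_of_nonneg (mw_nonneg _ _ _)]
  have h1 := kap_abs i a₁ b₁
  unfold tind mw
  have hp : (0:ℝ) < ((2:ℝ) ^ i)⁻¹ := by positivity
  have e : (1 / 2 : ℝ) ^ i = ((2:ℝ) ^ i)⁻¹ := by rw [one_div, inv_pow]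
  rw [e]
  have ha := abs_nonneg (kap i a₁ b₁)
  split_ifs at h1 ⊢ with h2 h3 h4 h5 h6
  all_goals first | nlinarith | (exfalso; have h9 := div_succ_of_div h2; tauto)

lemma K2_le (L a₁ a₂ b₁ b₂ : ℕ) : |K2 L a₁ a₂ b₁ b₂| ≤ Phi L a₁ a₂ b₁ b₂ := by
  unfold K2 Phi
  refine (Finset.abs_sum_le_sum_abs _ _).trans (Finset.sum_le_sum fun i _ => ?_)
  rw [abs_mul, abs_of_nonneg (mw_nonneg _ _ _)]
  have h1 := kap_abs i a₂ b₂
  unfold tind mw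
  have hp : (0:ℝ) < ((2:ℝ) ^ i)⁻¹ := by positivity
  have e : (1 / 2 : ℝ) ^ i = ((2:ℝ) ^ i)⁻¹ := by rw [one_div, inv_pow]
  have e' : ((2:ℝ) ^ (i + 1))⁻¹ = ((2:ℝ) ^ i)⁻¹ / 2 := by rw [pow_succ, mul_inv]; ring
  rw [e, e']
  have ha := abs_nonneg (kap i a₂ b₂)
  split_ifs at h1 ⊢ with h2 h3 h4 h5 h6
  all_goals first | (exfalso; simp_all; done) | nlinarith

lemma Aavg_step {L i a₁ a₂ : ℕ} (hi : i < L) (h1 : a₁ < 2 ^ L) (h2 : a₂ < 2 ^ L) (u : ℕ → ℕ → ℝ) :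
    Aavg L i u a₁ a₂ - Aavg L (i + 1) u a₁ a₂ =
    ∑ b₁ ∈ Finset.range (2 ^ L), ∑ b₂ ∈ Finset.range (2 ^ L),
      (kap i a₁ b₁ * mw i a₂ b₂ * (u (b₁ + 1) b₂ - u b₁ b₂)
        + mw (i + 1) a₁ b₁ * kap i a₂ b₂ * (u b₁ (b₂ + 1) - u b₁ b₂)) := by
  have e1 : ∑ c₁ ∈ Finset.range (2 ^ L), ∑ c₂ ∈ Finset.range (2 ^ L), mw i a₁ c₁ * mw i a₂ c₂ * u c₁ c₂ -
      ∑ c₁ ∈ Finset.range (2 ^ L), ∑ c₂ ∈ Finset.range (2 ^ L), mw (i + 1) a₁ c₁ * mw i a₂ c₂ * u c₁ c₂ =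
      ∑ b₁ ∈ Finset.range (2 ^ L), ∑ b₂ ∈ Finset.range (2 ^ L),
      kap i a₁ b₁ * mw i a₂ b₂ * (u (b₁ + 1) b₂ - u b₁ b₂) := by
    rw [Finset.sum_comm, Finset.sum_comm (f := fun c₁ c₂ => mw (i + 1) a₁ c₁ * mw i a₂ c₂ * u c₁ c₂),
      Finset.sum_comm (f := fun b₁ b₂ => kap i a₁ b₁ * mw i a₂ b₂ * (u (b₁ + 1) b₂ - u b₁ b₂)),
      ← Finset.sum_sub_distrib]
    refine Finset.sum_congr rfl fun c₂ _ => ?_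
    have := kap_sum hi h1 (fun c => mw i a₂ c₂ * u c c₂)
    simp only [← mul_assoc] at this
    rw [this]
    exact Finset.sum_congr rfl fun b _ => by ring
  have e2 : ∑ c₁ ∈ Finset.range (2 ^ L), ∑ c₂ ∈ Finset.range (2 ^ L), mw (i + 1) a₁ c₁ * mw i a₂ c₂ * u c₁ c₂ -
      ∑ c₁ ∈ Finset.range (2 ^ L), ∑ c₂ ∈ Finset.range (2 ^ L), mw (i + 1) a₁ c₁ * mw (i + 1) a₂ c₂ * u c₁ c₂ =
      ∑ b₁ ∈ Finset.range (2 ^ L), ∑ b₂ ∈ Finset.range (2 ^ L),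
      mw (i + 1) a₁ b₁ * kap i a₂ b₂ * (u b₁ (b₂ + 1) - u b₁ b₂) := by
    rw [← Finset.sum_sub_distrib]
    refine Finset.sum_congr rfl fun c₁ _ => ?_
    have := kap_sum hi h2 (fun c => mw (i + 1) a₁ c₁ * u c₁ c)
    calc _ = ∑ c ∈ Finset.range (2 ^ L), mw i a₂ c * (mw (i + 1) a₁ c₁ * u c₁ c) -
        ∑ c ∈ Finset.range (2 ^ L), mw (i + 1) a₂ c * (mw (i + 1) a₁ c₁ * u c₁ c) := by
          congr 1 <;> exact Finset.sum_congr rfl fun b _ => by ring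
      _ = _ := by
          rw [this]
          exact Finset.sum_congr rfl fun b _ => by ring
  unfold Aavg
  simp only [Finset.sum_add_distrib]
  rw [← e1, ← e2]
  ring

lemma Aavg_zero {L a₁ a₂ : ℕ} (h1 : a₁ < 2 ^ L) (h2 : a₂ < 2 ^ L) (u : ℕ → ℕ → ℝ) :
    Aavg L 0 u a₁ a₂ = u a₁ a₂ := by
  unfold Aavg mw
  simp only [pow_zero, Nat.div_one, inv_one]
  rw [Finset.sum_eq_single a₁, Finset.sum_eq_single a₂]
  · simp
  · intro b _ hb; simp [hb]
  · intro h; exact absurd (Finset.mem_range.2 h2) h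
  · intro b _ hb; simp [hb]
  · intro h; exact absurd (Finset.mem_range.2 h1) h

lemma Aavg_top {L a₁ a₂ : ℕ} (h1 : a₁ < 2 ^ L) (h2 : a₂ < 2 ^ L) (u : ℕ → ℕ → ℝ) :
    Aavg L L u a₁ a₂ = Aavg L L u 0 0 := by
  unfold Aavg mw
  simp only [Nat.div_eq_of_lt h1, Nat.div_eq_of_lt h2, Nat.zero_div]

lemma repr_formula {L a₁ a₂ : ℕ} (h1 : a₁ < 2 ^ L) (h2 : a₂ < 2 ^ L) (u : ℕ → ℕ → ℝ) :
    u a₁ a₂ = Aavg L L u 0 0 + ∑ b₁ ∈ Finset.range (2 ^ L), ∑ b₂ ∈ Finset.range (2 ^ L),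
      (K1 L a₁ a₂ b₁ b₂ * (u (b₁ + 1) b₂ - u b₁ b₂)
        + K2 L a₁ a₂ b₁ b₂ * (u b₁ (b₂ + 1) - u b₁ b₂)) := by
  have h := Finset.sum_range_sub' (fun i => Aavg L i u a₁ a₂) L
  rw [Aavg_zero h1 h2, Aavg_top h1 h2] at h
  rw [Finset.sum_congr rfl (fun i hi => Aavg_step (Finset.mem_range.1 hi) h1 h2 u)] at h
  rw [Finset.sum_comm] at h
  rw [← sub_eq_iff_eq_add', ← h]
  refine Finset.sum_congr rfl fun b₁ _ => ?_
  rw [Finset.sum_comm]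
  refine Finset.sum_congr rfl fun b₂ _ => ?_
  simp only [K1, K2, Finset.sum_mul, Finset.sum_add_distrib]

/-- deterministic upper bound -/
lemma upper_det {n L : ℕ} (p q : Fin n → ℕ × ℕ) (hp : ∀ k, (p k).1 < 2 ^ L ∧ (p k).2 < 2 ^ L)
    (hq : ∀ k, (q k).1 < 2 ^ L ∧ (q k).2 < 2 ^ L) (u : ℕ → ℕ → ℝ) (d : ℝ)
    (hu1 : ∀ a b, |u (a + 1) b - u a b| ≤ d) (hu2 : ∀ a b, |u a (b + 1) - u a b| ≤ d) :
    ∑ k, u (p k).1 (p k).2 - ∑ k, u (q k).1 (q k).2 ≤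
      d * ∑ b₁ ∈ Finset.range (2 ^ L), ∑ b₂ ∈ Finset.range (2 ^ L),
      (|∑ k, K1 L (p k).1 (p k).2 b₁ b₂ - ∑ k, K1 L (q k).1 (q k).2 b₁ b₂|
        + |∑ k, K2 L (p k).1 (p k).2 b₁ b₂ - ∑ k, K2 L (q k).1 (q k).2 b₁ b₂|) := by
  have hsum : ∀ p : Fin n → ℕ × ℕ, (∀ k, (p k).1 < 2 ^ L ∧ (p k).2 < 2 ^ L) →
      ∑ k, u (p k).1 (p k).2 = n * Aavg L L u 0 0 +
      ∑ b₁ ∈ Finset.range (2 ^ L), ∑ b₂ ∈ Finset.range (2 ^ L),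
      ((∑ k, K1 L (p k).1 (p k).2 b₁ b₂) * (u (b₁ + 1) b₂ - u b₁ b₂)
        + (∑ k, K2 L (p k).1 (p k).2 b₁ b₂) * (u b₁ (b₂ + 1) - u b₁ b₂)) := by
    intro p hp
    rw [Finset.sum_congr rfl fun k _ => repr_formula (hp k).1 (hp k).2 u, Finset.sum_add_distrib]
    congr 1
    · simp
    · rw [Finset.sum_comm]
      refine Finset.sum_congr rfl fun b₁ _ => ?_
      rw [Finset.sum_comm]
      refine Finset.sum_congr rfl fun b₂ _ => ?_
      rw [Finset.sum_add_distrib, Finset.sum_mul, Finset.sum_mul]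
  rw [hsum p hp, hsum q hq, add_sub_add_left_eq_sub, ← Finset.sum_sub_distrib, Finset.mul_sum]
  refine Finset.sum_le_sum fun b₁ _ => ?_
  rw [← Finset.sum_sub_distrib, Finset.mul_sum]
  refine Finset.sum_le_sum fun b₂ _ => ?_
  have key : ∀ A g : ℝ, |g| ≤ d → A * g ≤ d * |A| := by
    intro A g hg
    calc A * g ≤ |A * g| := le_abs_self _
      _ = |g| * |A| := by rw [abs_mul, mul_comm]
      _ ≤ _ := by gcongr
  have k1 := key (∑ k, K1 L (p k).1 (p k).2 b₁ b₂ - ∑ k, K1 L (q k).1 (q k).2 b₁ b₂) _ (hu1 b₁ b₂)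
  have k2 := key (∑ k, K2 L (p k).1 (p k).2 b₁ b₂ - ∑ k, K2 L (q k).1 (q k).2 b₁ b₂) _ (hu2 b₁ b₂)
  linarith

lemma geo_sq (L : ℕ) (t : ℕ → ℝ) (h0 : ∀ i, 0 ≤ t i) (h1 : ∀ i, t i ≤ 1) :
    (∑ i ∈ Finset.range L, (1 / 2 : ℝ) ^ i * t i) ^ 2 ≤ 4 * ∑ i ∈ Finset.range L, (1 / 4 : ℝ) ^ i * t i ∧
    0 ≤ ∑ i ∈ Finset.range L, (1 / 2 : ℝ) ^ i * t i ∧ ∑ i ∈ Finset.range L, (1 / 2 : ℝ) ^ i * t i ≤ 2 := by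
  induction L generalizing t with
  | zero => simp
  | succ L ih =>
    obtain ⟨a, b, c⟩ := ih (fun i => t (i + 1)) (fun i => h0 _) (fun i => h1 _)
    have e1 : ∑ i ∈ Finset.range (L + 1), (1 / 2 : ℝ) ^ i * t i =
        t 0 + (1 / 2) * ∑ i ∈ Finset.range L, (1 / 2 : ℝ) ^ i * t (i + 1) := by
      rw [Finset.sum_range_succ', Finset.mul_sum, add_comm]; congr 1
      · simp
      · exact Finset.sum_congr rfl fun i _ => by ring
    have e2 : ∑ i ∈ Finset.range (L + 1), (1 / 4 : ℝ) ^ i * t i =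
        t 0 + (1 / 4) * ∑ i ∈ Finset.range L, (1 / 4 : ℝ) ^ i * t (i + 1) := by
      rw [Finset.sum_range_succ', Finset.mul_sum, add_comm]; congr 1
      · simp
      · exact Finset.sum_congr rfl fun i _ => by ring
    rw [e1, e2]
    set S := ∑ i ∈ Finset.range L, (1 / 2 : ℝ) ^ i * t (i + 1)
    have := h0 0; have := h1 0
    refine ⟨?_, by linarith, by linarith⟩
    nlinarith
end

section

def cellN (J : ℕ) (t : ℝ) : ℕ := ⌊(2:ℝ) ^ J * t⌋₊

lemma cellN_meas (J : ℕ) : Measurable (cellN J) := by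
  unfold cellN
  exact Nat.measurable_floor.comp (measurable_id.const_mul _)

lemma cell2_meas (J : ℕ) (F : ℕ → ℕ → ℝ) :
    Measurable (fun x : Fin 2 → ℝ => F (cellN J (x 0)) (cellN J (x 1))) := by
  have h : Measurable (fun p : ℕ × ℕ => F p.1 p.2) := measurable_of_countable _
  exact h.comp (((cellN_meas J).comp (measurable_pi_apply 0)).prodMk
    ((cellN_meas J).comp (measurable_pi_apply 1)))

lemma cellN_lt {J : ℕ} {t : ℝ} (h : t ≤ 1) : cellN J t < 2 ^ (J + 1) := by
  unfold cellN
  have h1 : ⌊(2:ℝ) ^ J * t⌋₊ ≤ 2 ^ J := by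
    apply Nat.floor_le_of_le
    push_cast
    have : (0:ℝ) < 2 ^ J := by positivity
    nlinarith
  have : 0 < 2 ^ J := by positivity
  rw [pow_succ]; omega

lemma cellN_near {J : ℕ} {t : ℝ} (h : 0 ≤ t) : |t - cellN J t / (2:ℝ) ^ J| ≤ ((2:ℝ) ^ J)⁻¹ := by
  unfold cellN
  have hp : (0:ℝ) < 2 ^ J := by positivity
  have h1 := Nat.floor_le (by positivity : 0 ≤ (2:ℝ) ^ J * t)
  have h2 := Nat.lt_floor_add_one ((2:ℝ) ^ J * t)
  have e : t - ⌊(2:ℝ) ^ J * t⌋₊ / (2:ℝ) ^ J = ((2:ℝ) ^ J * t - ⌊(2:ℝ) ^ J * t⌋₊) * ((2:ℝ) ^ J)⁻¹ := by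
    field_simp
  rw [e, abs_mul, abs_of_pos (inv_pos.2 hp), abs_of_nonneg (by linarith)]
  have := inv_pos.2 hp
  nlinarith

lemma cellN_block {J m c : ℕ} {t : ℝ} (h : 0 ≤ t) (hc : cellN J t / 2 ^ m = c) :
    t ∈ Set.Icc (c * (2:ℝ) ^ m / 2 ^ J) ((c + 1) * (2:ℝ) ^ m / 2 ^ J) := by
  have hp : (0:ℝ) < 2 ^ J := by positivity
  have h1 := Nat.floor_le (by positivity : 0 ≤ (2:ℝ) ^ J * t)
  have h2 := Nat.lt_floor_add_one ((2:ℝ) ^ J * t)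
  change (cellN J t : ℝ) ≤ _ at h1
  change _ < (cellN J t : ℝ) + 1 at h2
  have a1 : c * 2 ^ m ≤ cellN J t := by rw [← hc]; exact Nat.div_mul_le_self _ _
  have a2 : cellN J t + 1 ≤ (c + 1) * 2 ^ m := by
    rw [← hc]
    exact Nat.lt_mul_of_div_lt (Nat.lt_succ_self _) (by positivity)
  have b1 : (c:ℝ) * 2 ^ m ≤ cellN J t := by exact_mod_cast a1
  have b2 : (cellN J t:ℝ) + 1 ≤ (c + 1) * 2 ^ m := by exact_mod_cast a2
  constructor
  · rw [div_le_iff₀ hp]; nlinarith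
  · rw [le_div_iff₀ hp]; nlinarith

lemma tind_nonneg (i a₁ a₂ b₁ b₂ : ℕ) : 0 ≤ tind i a₁ a₂ b₁ b₂ := by
  unfold tind; split_ifs <;> norm_num
lemma tind_le (i a₁ a₂ b₁ b₂ : ℕ) : tind i a₁ a₂ b₁ b₂ ≤ 1 := by
  unfold tind; split_ifs <;> norm_num

lemma tind_int (J i b₁ b₂ : ℕ) :
    ∫ x, tind i (cellN J (x 0)) (cellN J (x 1)) b₁ b₂ ∂uniformSquare ≤ (4:ℝ) ^ (i + 1) / 4 ^ J := by
  set c₁ := b₁ / 2 ^ (i + 1)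
  set c₂ := b₂ / 2 ^ (i + 1)
  let lo : Fin 2 → ℝ := ![c₁ * (2:ℝ) ^ (i + 1) / 2 ^ J, c₂ * (2:ℝ) ^ (i + 1) / 2 ^ J]
  let hi : Fin 2 → ℝ := ![(c₁ + 1) * (2:ℝ) ^ (i + 1) / 2 ^ J, (c₂ + 1) * (2:ℝ) ^ (i + 1) / 2 ^ J]
  have hle : lo ≤ hi := by
    intro k
    fin_cases k <;> simp only [lo, hi, Fin.zero_eta, Fin.mk_one, Matrix.cons_val_zero, Matrix.cons_val_one] <;> gcongr <;> linarith
  have key : ∀ᵐ x ∂uniformSquare, tind i (cellN J (x 0)) (cellN J (x 1)) b₁ b₂ ≤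
      (Set.Icc lo hi).indicator (fun _ => (1:ℝ)) x := by
    have h0 : ∀ᵐ x ∂uniformSquare, x ∈ unitSquare := ae_restrict_mem unitSquare_meas
    filter_upwards [h0] with x hx
    unfold tind
    split_ifs with h
    · rw [Set.indicator_of_mem]
      have p1 := cellN_block (hx 0).1 h.1
      have p2 := cellN_block (hx 1).1 h.2
      constructor
      · intro k; fin_cases k
        · exact p1.1
        · exact p2.1
      · intro k; fin_cases k
        · exact p1.2
        · exact p2.2
    · exact Set.indicator_nonneg (fun _ _ => zero_le_one) _
  have hint : Integrable (fun x : Fin 2 → ℝ => tind i (cellN J (x 0)) (cellN J (x 1)) b₁ b₂) uniformSquare :=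
    Integrable.of_bound (cell2_meas J (fun a b => tind i a b b₁ b₂)).aestronglyMeasurable 1
      (Filter.Eventually.of_forall fun x => by
        rw [Real.norm_eq_abs, abs_of_nonneg (tind_nonneg _ _ _ _ _)]; exact tind_le _ _ _ _ _)
  refine (integral_mono_ae hint ((integrable_const (1:ℝ)).indicator measurableSet_Icc) key).trans ?_
  rw [integral_indicator_const _ measurableSet_Icc, smul_eq_mul, mul_one]
  have h1 : uniformSquare.real (Set.Icc lo hi) ≤ volume.real (Set.Icc lo hi) := by
    apply ENNReal.toReal_mono
    · rw [Real.volume_Icc_pi]; exact (ENNReal.prod_lt_top (fun _ _ => ENNReal.ofReal_lt_top)).ne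
    · exact Measure.restrict_apply_le _ _
  refine h1.trans (le_of_eq ?_)
  rw [Measure.real, Real.volume_Icc_pi_toReal hle, Fin.prod_univ_two]
  simp only [lo, hi, Matrix.cons_val_zero, Matrix.cons_val_one]
  have e4 : ∀ k : ℕ, (4:ℝ) ^ k = 2 ^ k * 2 ^ k := fun k => by rw [← mul_pow]; norm_num
  rw [e4, e4]
  have hp : (2:ℝ) ^ J ≠ 0 := by positivity
  field_simp
  ring

lemma phi_sq_int (J L b₁ b₂ : ℕ) (φ : ℕ → ℕ → ℝ) (hφ : ∀ a₁ a₂, |φ a₁ a₂| ≤ Phi L a₁ a₂ b₁ b₂) :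
    ∫ x, φ (cellN J (x 0)) (cellN J (x 1)) ^ 2 ∂uniformSquare ≤ 16 * L / 4 ^ J := by
  have hint : ∀ i, Integrable (fun x : Fin 2 → ℝ => tind i (cellN J (x 0)) (cellN J (x 1)) b₁ b₂) uniformSquare :=
    fun i => Integrable.of_bound (cell2_meas J (fun a b => tind i a b b₁ b₂)).aestronglyMeasurable 1
      (Filter.Eventually.of_forall fun x => by
        rw [Real.norm_eq_abs, abs_of_nonneg (tind_nonneg _ _ _ _ _)]; exact tind_le _ _ _ _ _)
  have h1 : ∀ x : Fin 2 → ℝ, φ (cellN J (x 0)) (cellN J (x 1)) ^ 2 ≤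
      4 * ∑ i ∈ Finset.range L, (1 / 4 : ℝ) ^ i * tind i (cellN J (x 0)) (cellN J (x 1)) b₁ b₂ := by
    intro x
    have g := geo_sq L (fun i => tind i (cellN J (x 0)) (cellN J (x 1)) b₁ b₂)
      (fun i => tind_nonneg _ _ _ _ _) (fun i => tind_le _ _ _ _ _)
    refine le_trans ?_ g.1
    rw [← sq_abs]
    exact pow_le_pow_left₀ (abs_nonneg _) (hφ _ _) 2
  refine (integral_mono_of_nonneg (Filter.Eventually.of_forall fun x => sq_nonneg _) ?_
    (Filter.Eventually.of_forall h1)).trans ?_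
  · exact (integrable_finsetSum _ fun i _ => (hint i).const_mul _).const_mul _
  rw [integral_const_mul, integral_finsetSum _ fun i _ => (hint i).const_mul _]
  have h2 : ∑ i ∈ Finset.range L, ∫ x, (1 / 4 : ℝ) ^ i * tind i (cellN J (x 0)) (cellN J (x 1)) b₁ b₂ ∂uniformSquare
      ≤ ∑ i ∈ Finset.range L, 4 / (4:ℝ) ^ J := by
    refine Finset.sum_le_sum fun i _ => ?_
    rw [integral_const_mul]
    calc _ ≤ (1 / 4 : ℝ) ^ i * ((4:ℝ) ^ (i + 1) / 4 ^ J) := by gcongr; exact tind_int J i b₁ b₂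
      _ = _ := by rw [one_div, inv_pow, pow_succ]; field_simp
  rw [Finset.sum_const, Finset.card_range, nsmul_eq_mul] at h2
  calc _ ≤ 4 * ((L:ℝ) * (4 / 4 ^ J)) := by gcongr
    _ = _ := by ring

lemma Phi_le (L a₁ a₂ b₁ b₂ : ℕ) : Phi L a₁ a₂ b₁ b₂ ≤ 2 :=
  (geo_sq L (fun i => tind i a₁ a₂ b₁ b₂) (fun i => tind_nonneg _ _ _ _ _) (fun i => tind_le _ _ _ _ _)).2.2

variable {n : ℕ} {Ω : Type} [MeasurableSpace Ω] {P : Measure Ω} {X Y : Fin n → Ω → (Fin 2 → ℝ)}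

def phi1 (J b₁ b₂ : ℕ) (x : Fin 2 → ℝ) : ℝ := K1 (J + 1) (cellN J (x 0)) (cellN J (x 1)) b₁ b₂
def phi2 (J b₁ b₂ : ℕ) (x : Fin 2 → ℝ) : ℝ := K2 (J + 1) (cellN J (x 0)) (cellN J (x 1)) b₁ b₂

lemma mc_upper_pt (hn : 0 < n) (J : ℕ) (ω : Ω)
    (hω : ∀ k, X k ω ∈ unitSquare ∧ Y k ω ∈ unitSquare) :
    n * matchingCost (fun k => X k ω) (fun k => Y k ω) ≤ 4 * n * ((2:ℝ) ^ J)⁻¹ +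
      ((2:ℝ) ^ J)⁻¹ * ∑ b₁ ∈ Finset.range (2 ^ (J + 1)), ∑ b₂ ∈ Finset.range (2 ^ (J + 1)),
        (|Dsum X Y (phi1 J b₁ b₂) ω| + |Dsum X Y (phi2 J b₁ b₂) ω|) := by
  obtain ⟨f, hf, hmc⟩ := mc_dual hn (fun k => X k ω) (fun k => Y k ω)
  have hp : (0:ℝ) < ((2:ℝ) ^ J)⁻¹ := by positivity
  let u : ℕ → ℕ → ℝ := fun a b => f ![a / (2:ℝ) ^ J, b / (2:ℝ) ^ J]
  have hu : ∀ a b, |u (a + 1) b - u a b| ≤ ((2:ℝ) ^ J)⁻¹ ∧ |u a (b + 1) - u a b| ≤ ((2:ℝ) ^ J)⁻¹ := by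
    intro a b
    have e : ∀ a : ℕ, ((a + 1 : ℕ):ℝ) / (2:ℝ) ^ J - a / 2 ^ J = ((2:ℝ) ^ J)⁻¹ := by
      intro a; push_cast; field_simp; ring
    constructor
    · refine (hf _ _).trans ((ed_le _ _).trans ?_)
      simp only [Matrix.cons_val_zero, Matrix.cons_val_one, e, sub_self, abs_zero, add_zero, abs_of_pos hp, le_refl]
    · refine (hf _ _).trans ((ed_le _ _).trans ?_)
      simp only [Matrix.cons_val_zero, Matrix.cons_val_one, e, sub_self, abs_zero, zero_add, abs_of_pos hp, le_refl]
  have hr : ∀ x ∈ unitSquare, |f x - u (cellN J (x 0)) (cellN J (x 1))| ≤ 2 * ((2:ℝ) ^ J)⁻¹ := by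
    intro x hx
    refine (hf _ _).trans ((ed_le _ _).trans ?_)
    have := cellN_near (J := J) (hx 0).1
    have := cellN_near (J := J) (hx 1).1
    simp only [Matrix.cons_val_zero, Matrix.cons_val_one]
    linarith
  have hd := upper_det (L := J + 1) (fun k => (cellN J (X k ω 0), cellN J (X k ω 1)))
    (fun k => (cellN J (Y k ω 0), cellN J (Y k ω 1)))
    (fun k => ⟨cellN_lt ((hω k).1 0).2, cellN_lt ((hω k).1 1).2⟩)
    (fun k => ⟨cellN_lt ((hω k).2 0).2, cellN_lt ((hω k).2 1).2⟩) u ((2:ℝ) ^ J)⁻¹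
    (fun a b => (hu a b).1) (fun a b => (hu a b).2)
  have hX : ∑ k, f (X k ω) ≤ ∑ k, u (cellN J (X k ω 0)) (cellN J (X k ω 1)) + n * (2 * ((2:ℝ) ^ J)⁻¹) := by
    have : ∑ k, f (X k ω) ≤ ∑ k, (u (cellN J (X k ω 0)) (cellN J (X k ω 1)) + 2 * ((2:ℝ) ^ J)⁻¹) :=
      Finset.sum_le_sum fun k _ => by
        have := (abs_le.1 (hr _ (hω k).1)).2; linarith
    rw [Finset.sum_add_distrib] at this
    simpa using this
  have hY : ∑ k, u (cellN J (Y k ω 0)) (cellN J (Y k ω 1)) ≤ ∑ k, f (Y k ω) + n * (2 * ((2:ℝ) ^ J)⁻¹) := by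
    have : ∑ k, u (cellN J (Y k ω 0)) (cellN J (Y k ω 1)) ≤ ∑ k, (f (Y k ω) + 2 * ((2:ℝ) ^ J)⁻¹) :=
      Finset.sum_le_sum fun k _ => by
        have := (abs_le.1 (hr _ (hω k).2)).1; linarith
    rw [Finset.sum_add_distrib] at this
    simpa using this
  simp only [Dsum, phi1, phi2]
  linarith

lemma phi1_meas (J b₁ b₂ : ℕ) : Measurable (phi1 J b₁ b₂) := cell2_meas J (fun a b => K1 (J + 1) a b b₁ b₂)
lemma phi2_meas (J b₁ b₂ : ℕ) : Measurable (phi2 J b₁ b₂) := cell2_meas J (fun a b => K2 (J + 1) a b b₁ b₂)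
lemma phi1_bd (J b₁ b₂ : ℕ) (x) : |phi1 J b₁ b₂ x| ≤ 2 := (K1_le _ _ _ _ _).trans (Phi_le _ _ _ _ _)
lemma phi2_bd (J b₁ b₂ : ℕ) (x) : |phi2 J b₁ b₂ x| ≤ 2 := (K2_le _ _ _ _ _).trans (Phi_le _ _ _ _ _)

lemma Samp.upper_J (S : Samp P X Y) (hn : 0 < n) (J : ℕ) :
    n * ∫ ω, matchingCost (fun k => X k ω) (fun k => Y k ω) ∂P ≤
      4 * n * ((2:ℝ) ^ J)⁻¹ + 8 * √(32 * n * (J + 1)) := by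
  have := S.prob
  have i1 : ∀ b₁ b₂, Integrable (fun ω => |Dsum X Y (phi1 J b₁ b₂) ω|) P := fun b₁ b₂ =>
    ((S.D_memLp (phi1_meas J b₁ b₂) (phi1_bd J b₁ b₂) 1).integrable le_rfl).abs
  have i2 : ∀ b₁ b₂, Integrable (fun ω => |Dsum X Y (phi2 J b₁ b₂) ω|) P := fun b₁ b₂ =>
    ((S.D_memLp (phi2_meas J b₁ b₂) (phi2_bd J b₁ b₂) 1).integrable le_rfl).abs
  have iS : ∀ b₁, Integrable (fun ω => ∑ b₂ ∈ Finset.range (2 ^ (J + 1)),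
        (|Dsum X Y (phi1 J b₁ b₂) ω| + |Dsum X Y (phi2 J b₁ b₂) ω|)) P := fun b₁ =>
    integrable_finsetSum _ fun b₂ _ => (i1 b₁ b₂).add (i2 b₁ b₂)
  rw [← integral_const_mul]
  have h := integral_mono_ae (S.integrable_mc.const_mul (n:ℝ))
    ((integrable_const (4 * n * ((2:ℝ) ^ J)⁻¹)).add
      ((integrable_finsetSum (Finset.range (2 ^ (J + 1))) fun b₁ _ => iS b₁).const_mul ((2:ℝ) ^ J)⁻¹))
    (by filter_upwards [S.ae_mem] with ω hω using mc_upper_pt hn J ω hω)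
  refine h.trans ?_
  simp only [Pi.add_apply]
  rw [integral_add (integrable_const _)
    ((integrable_finsetSum (Finset.range (2 ^ (J + 1))) fun b₁ _ => iS b₁).const_mul ((2:ℝ) ^ J)⁻¹),
    integral_const, probReal_univ, one_smul, integral_const_mul, integral_finsetSum _ fun b₁ _ => iS b₁]
  have hV : (2 * n * (16 * ((J + 1 : ℕ) : ℝ) / 4 ^ J)) = (32 * n * (J + 1)) * (((2:ℝ) ^ J)⁻¹) ^ 2 := by
    have e4 : (4:ℝ) ^ J = 2 ^ J * 2 ^ J := by rw [← mul_pow]; norm_num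
    rw [e4]; push_cast; field_simp; ring
  have hsq : √(2 * n * (16 * ((J + 1 : ℕ) : ℝ) / 4 ^ J)) = √(32 * n * (J + 1)) * ((2:ℝ) ^ J)⁻¹ := by
    rw [hV, Real.sqrt_mul (by positivity), Real.sqrt_sq (by positivity)]
  have hb : ∀ b₁ ∈ Finset.range (2 ^ (J + 1)), ∫ ω, ∑ b₂ ∈ Finset.range (2 ^ (J + 1)),
        (|Dsum X Y (phi1 J b₁ b₂) ω| + |Dsum X Y (phi2 J b₁ b₂) ω|) ∂P ≤
        (2:ℝ) ^ (J + 1) * (2 * (√(32 * n * (J + 1)) * ((2:ℝ) ^ J)⁻¹)) := by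
    intro b₁ _
    have i3 : ∀ b₂, Integrable (fun ω => |Dsum X Y (phi1 J b₁ b₂) ω| + |Dsum X Y (phi2 J b₁ b₂) ω|) P :=
      fun b₂ => (i1 b₁ b₂).add (i2 b₁ b₂)
    rw [integral_finsetSum _ fun b₂ _ => i3 b₂]
    have : ∀ b₂ ∈ Finset.range (2 ^ (J + 1)), ∫ ω, (|Dsum X Y (phi1 J b₁ b₂) ω| + |Dsum X Y (phi2 J b₁ b₂) ω|) ∂P
        ≤ 2 * (√(32 * n * (J + 1)) * ((2:ℝ) ^ J)⁻¹) := by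
      intro b₂ _
      rw [integral_add (i1 b₁ b₂) (i2 b₁ b₂), ← hsq]
      have a1 := S.abs_moment (phi1_meas J b₁ b₂) (phi1_bd J b₁ b₂)
        (phi_sq_int J (J + 1) b₁ b₂ (fun a b => K1 (J + 1) a b b₁ b₂) (fun a b => K1_le _ _ _ _ _))
      have a2 := S.abs_moment (phi2_meas J b₁ b₂) (phi2_bd J b₁ b₂)
        (phi_sq_int J (J + 1) b₁ b₂ (fun a b => K2 (J + 1) a b b₁ b₂) (fun a b => K2_le _ _ _ _ _))
      linarith
    refine (Finset.sum_le_sum this).trans (le_of_eq ?_)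
    rw [Finset.sum_const, Finset.card_range, nsmul_eq_mul]; push_cast; rfl
  have hs := Finset.sum_le_sum hb
  rw [Finset.sum_const, Finset.card_range, nsmul_eq_mul] at hs
  have hp : (0:ℝ) < ((2:ℝ) ^ J)⁻¹ := by positivity
  have := mul_le_mul_of_nonneg_left hs hp.le
  have e : ((2:ℝ) ^ J)⁻¹ * (((2 ^ (J + 1) : ℕ):ℝ) * ((2:ℝ) ^ (J + 1) * (2 * (√(32 * n * (J + 1)) * ((2:ℝ) ^ J)⁻¹)))) = 8 * √(32 * n * (J + 1)) := by
    push_cast; rw [pow_succ]; field_simp; ring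
  rw [e] at this
  linarith

lemma Samp.upper (S : Samp P X Y) (hn : 2 ≤ n) :
    ∫ ω, matchingCost (fun k => X k ω) (fun k => Y k ω) ∂P ≤ 120 * √(Real.log n / n) := by
  have h := S.upper_J (by omega) (Nat.log 2 n + 1)
  have hn0 : (0:ℝ) < n := by positivity
  have hn2 : (2:ℝ) ≤ n := by exact_mod_cast hn
  set J := Nat.log 2 n + 1 with hJ
  have h2J : (n:ℝ) ≤ 2 ^ J := by
    exact_mod_cast (Nat.lt_pow_succ_log_self (by norm_num) n).le
  have hlow : ((2:ℝ)) ^ (Nat.log 2 n) ≤ n := by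
    exact_mod_cast Nat.pow_log_le_self 2 (by omega)
  have hlog1 : 1 ≤ Nat.log 2 n := Nat.log_pos (by norm_num) hn
  have hlog1' : (1:ℝ) ≤ Nat.log 2 n := by exact_mod_cast hlog1
  have hl2 := Real.log_two_gt_d9
  have hlogn : (Nat.log 2 n : ℝ) * Real.log 2 ≤ Real.log n := by
    rw [← Real.log_pow]; exact Real.log_le_log (by positivity) hlow
  have hJl : ((J:ℝ) + 1) ≤ 6 * Real.log n := by
    rw [hJ]; push_cast; nlinarith
  have hfirst : 4 * n * ((2:ℝ) ^ J)⁻¹ ≤ 4 := by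
    rw [← div_eq_mul_inv, div_le_iff₀ (by positivity)]; linarith
  have hlogpos : 0 < Real.log n := Real.log_pos (by linarith)
  have hnl : 1 ≤ n * Real.log n := by nlinarith
  have hs1 : 1 ≤ √(n * Real.log n) := Real.one_le_sqrt.2 hnl
  have hs2 : √(32 * n * (J + 1)) ≤ 14 * √(n * Real.log n) := by
    rw [show (14:ℝ) = √(14 ^ 2) by rw [Real.sqrt_sq (by norm_num)], ← Real.sqrt_mul (by positivity)]
    apply Real.sqrt_le_sqrt
    have : 32 * n * ((J:ℝ) + 1) ≤ 32 * n * (6 * Real.log n) := by gcongr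
    have : 0 ≤ n * Real.log n := by positivity
    linarith
  have e : √(Real.log n / n) = √(n * Real.log n) / n := by
    rw [show Real.log n / n = (n * Real.log n) / n ^ 2 by field_simp, Real.sqrt_div (by positivity), Real.sqrt_sq hn0.le]
  rw [e, mul_div_assoc', le_div_iff₀ hn0]
  linarith
end

section

def pp (t : ℝ) : ℝ := max 0 (t * (1 - t))
def bb (t : ℝ) : ℝ := pp t ^ 2
def bd (t : ℝ) : ℝ := 2 * pp t * (1 - 2 * t)
def clp (t : ℝ) : ℝ := max 0 (min 1 t)
def SuppU (F : ℝ → ℝ) : Prop := ∀ t, t ≤ 0 ∨ 1 ≤ t → F t = 0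

lemma pp_supp : SuppU pp := by
  intro t ht
  unfold pp
  apply max_eq_left
  rcases ht with h | h <;> nlinarith

lemma bb_supp : SuppU bb := by
  intro t ht; rw [bb, pp_supp t ht]; norm_num
lemma bd_supp : SuppU bd := by
  intro t ht; rw [bd, pp_supp t ht]; norm_num

lemma pp_mid {t : ℝ} (h0 : 0 ≤ t) (h1 : t ≤ 1) : pp t = t * (1 - t) := by
  unfold pp; apply max_eq_right; nlinarith

lemma clp_mem (t : ℝ) : 0 ≤ clp t ∧ clp t ≤ 1 :=
  ⟨le_max_left _ _, max_le zero_le_one (min_le_left _ _)⟩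

lemma clp_lip (s t : ℝ) : |clp s - clp t| ≤ |s - t| := by
  unfold clp
  rw [max_comm 0, max_comm 0]
  refine (abs_max_sub_max_le_abs _ _ _).trans ?_
  rw [min_comm 1, min_comm 1]
  exact (abs_min_sub_min_le_max _ _ _ _).trans (by simp)

lemma clp_cases (t : ℝ) : (0 ≤ t ∧ t ≤ 1 ∧ clp t = t) ∨ ((t ≤ 0 ∨ 1 ≤ t) ∧ (clp t = 0 ∨ clp t = 1)) := by
  unfold clp
  rcases le_total t 0 with h | h
  · right; exact ⟨Or.inl h, Or.inl (by rw [min_eq_right (by linarith)]; exact max_eq_left h)⟩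
  · rcases le_total 1 t with h' | h'
    · right; exact ⟨Or.inr h', Or.inr (by rw [min_eq_left h']; norm_num)⟩
    · left; exact ⟨h, h', by rw [min_eq_right h', max_eq_right h]⟩

lemma bb_clp (t : ℝ) : bb t = (clp t * (1 - clp t)) ^ 2 := by
  rcases clp_cases t with ⟨h0, h1, h⟩ | ⟨h0, h⟩
  · rw [h, bb, pp_mid h0 h1]
  · rw [bb_supp t h0]; rcases h with h | h <;> rw [h] <;> norm_num

lemma bd_clp (t : ℝ) : bd t = 2 * (clp t * (1 - clp t)) * (1 - 2 * clp t) := by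
  rcases clp_cases t with ⟨h0, h1, h⟩ | ⟨h0, h⟩
  · rw [h, bd, pp_mid h0 h1]
  · rw [bd_supp t h0]; rcases h with h | h <;> rw [h] <;> norm_num

lemma bb_nonneg (t : ℝ) : 0 ≤ bb t := sq_nonneg _
lemma bb_le (t : ℝ) : bb t ≤ 1 / 16 := by
  rw [bb_clp]
  have := clp_mem t
  have h1 : clp t * (1 - clp t) ≤ 1 / 4 := by nlinarith [sq_nonneg (clp t - 1 / 2)]
  have h0 : 0 ≤ clp t * (1 - clp t) := by nlinarith
  nlinarith
lemma bd_abs (t : ℝ) : |bd t| ≤ 1 / 2 := by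
  rw [bd_clp, abs_mul]
  have := clp_mem t
  have h1 : clp t * (1 - clp t) ≤ 1 / 4 := by nlinarith [sq_nonneg (clp t - 1 / 2)]
  have h0 : 0 ≤ clp t * (1 - clp t) := by nlinarith
  have h2 : |1 - 2 * clp t| ≤ 1 := by rw [abs_le]; constructor <;> linarith
  rw [abs_of_nonneg (by linarith)]
  have := abs_nonneg (1 - 2 * clp t)
  nlinarith
lemma bb_abs (t : ℝ) : |bb t| ≤ 1 / 16 := by rw [abs_of_nonneg (bb_nonneg t)]; exact bb_le t

lemma bb_lip (s t : ℝ) : |bb s - bb t| ≤ 1 / 2 * |s - t| := by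
  rw [bb_clp, bb_clp]
  have hs := clp_mem s
  have ht := clp_mem t
  have hc := clp_lip s t
  set x := clp s; set y := clp t
  have e : (x * (1 - x)) ^ 2 - (y * (1 - y)) ^ 2 = ((1 - x - y) * (x * (1 - x) + y * (1 - y))) * (x - y) := by ring
  rw [e, abs_mul]
  have h1 : x * (1 - x) ≤ 1 / 4 := by nlinarith [sq_nonneg (x - 1 / 2)]
  have h0 : 0 ≤ x * (1 - x) := by nlinarith
  have h1' : y * (1 - y) ≤ 1 / 4 := by nlinarith [sq_nonneg (y - 1 / 2)]
  have h0' : 0 ≤ y * (1 - y) := by nlinarith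
  have : |(1 - x - y) * (x * (1 - x) + y * (1 - y))| ≤ 1 / 2 := by
    rw [abs_mul, abs_of_nonneg (by linarith : 0 ≤ x * (1 - x) + y * (1 - y))]
    have : |1 - x - y| ≤ 1 := by rw [abs_le]; constructor <;> linarith
    have := abs_nonneg (1 - x - y)
    nlinarith
  exact mul_le_mul this hc (abs_nonneg _) (by norm_num)

lemma bd_lip (s t : ℝ) : |bd s - bd t| ≤ 2 * |s - t| := by
  rw [bd_clp, bd_clp]
  have hs := clp_mem s
  have ht := clp_mem t
  have hc := clp_lip s t
  set x := clp s; set y := clp t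
  have e : 2 * (x * (1 - x)) * (1 - 2 * x) - 2 * (y * (1 - y)) * (1 - 2 * y)
      = (2 * (1 - 3 * (x + y) + 2 * (x ^ 2 + x * y + y ^ 2))) * (x - y) := by ring
  rw [e, abs_mul]
  have : |2 * (1 - 3 * (x + y) + 2 * (x ^ 2 + x * y + y ^ 2))| ≤ 2 := by
    rw [abs_le]; constructor
    · nlinarith [sq_nonneg (x + y - 1), sq_nonneg (x - y)]
    · nlinarith [mul_nonneg hs.1 (sub_nonneg.2 hs.2), mul_nonneg ht.1 (sub_nonneg.2 ht.2),
        mul_nonneg hs.1 (sub_nonneg.2 ht.2), mul_nonneg ht.1 (sub_nonneg.2 hs.2), mul_nonneg hs.1 ht.1, mul_nonneg (sub_nonneg.2 hs.2) (sub_nonneg.2 ht.2)]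
  exact mul_le_mul this hc (abs_nonneg _) (by norm_num)

lemma sqmax_deriv (x : ℝ) : HasDerivAt (fun t : ℝ => (max 0 t) ^ 2) (2 * max 0 x) x := by
  have hb : (fun t : ℝ => (max 0 t) ^ 2 - (max 0 x) ^ 2 - 2 * max 0 x * (t - x)) =O[nhds x] fun t => ‖t - x‖ ^ 2 := by
    apply Asymptotics.IsBigO.of_bound 1
    refine Filter.Eventually.of_forall fun t => ?_
    simp only [Real.norm_eq_abs, abs_pow, abs_abs, one_mul, sq_abs]
    rw [abs_le]
    rcases max_cases 0 t with ⟨h, h'⟩ | ⟨h, h'⟩ <;> rcases max_cases 0 x with ⟨g, g'⟩ | ⟨g, g'⟩ <;>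
      rw [h, g] <;> constructor <;> nlinarith [sq_nonneg (t - x)]
  have h0 := (hb.hasFDerivAt (by norm_num)).hasDerivAt
  have h1 := ((h0.add_const ((max 0 x) ^ 2)).add (((hasDerivAt_id x).sub_const x).const_mul (2 * max 0 x)))
  refine (h1.congr_deriv (by simp)).congr_of_eventuallyEq (Filter.Eventually.of_forall fun t => ?_)
  simp
  ring

lemma bb_deriv (x : ℝ) : HasDerivAt bb (bd x) x := by
  have h1 : HasDerivAt (fun t : ℝ => t * (1 - t)) (1 - 2 * x) x := by
    have := (hasDerivAt_id x).mul ((hasDerivAt_id x).const_sub 1)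
    refine this.congr_deriv ?_
    simp; ring
  exact (sqmax_deriv (x * (1 - x))).comp x h1

lemma bb_cont : Continuous bb := by unfold bb pp; fun_prop
lemma bd_cont : Continuous bd := by unfold bd pp; fun_prop

structure Nice (F H : ℝ → ℝ) : Prop where
  F0 : SuppU F
  H0 : SuppU H
  Fm : Continuous F
  Hm : Continuous H
  Fb : ∀ t, |F t| ≤ 1
  Hb : ∀ t, |H t| ≤ 1
  dif : ∀ u v u' v', |F u * H v - F u' * H v'| ≤ (|u - u'| + |v - v'|) / 4
  int : (∫ t, F t) * (∫ t, H t) = 0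

lemma int_supp {F : ℝ → ℝ} (h : SuppU F) : ∫ t, F t = ∫ t in (0:ℝ)..1, F t := by
  rw [intervalIntegral.integral_of_le zero_le_one, setIntegral_eq_integral_of_forall_compl_eq_zero]
  intro x hx
  apply h
  by_contra hc
  push Not at hc
  exact hx ⟨hc.1, hc.2.le⟩

lemma bd_int : ∫ t, bd t = 0 := by
  rw [int_supp bd_supp, intervalIntegral.integral_eq_sub_of_hasDerivAt (fun x _ => bb_deriv x)
    (bd_cont.intervalIntegrable _ _), bb_supp 1 (Or.inr le_rfl), bb_supp 0 (Or.inl le_rfl), sub_self]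

lemma dif_aux (u v u' v' : ℝ) : |bd u * bb v - bd u' * bb v'| ≤ (|u - u'| + |v - v'|) / 4 := by
  have e : bd u * bb v - bd u' * bb v' = (bd u - bd u') * bb v + bd u' * (bb v - bb v') := by ring
  rw [e]
  refine (abs_add_le _ _).trans ?_
  rw [abs_mul, abs_mul]
  have h1 := mul_le_mul (bd_lip u u') (bb_abs v) (abs_nonneg _) (by positivity)
  have h2 := mul_le_mul (bd_abs u') (bb_lip v v') (abs_nonneg _) (by positivity)
  have := abs_nonneg (u - u')
  linarith

lemma nice1 : Nice bd bb where
  F0 := bd_supp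
  H0 := bb_supp
  Fm := bd_cont
  Hm := bb_cont
  Fb t := (bd_abs t).trans (by norm_num)
  Hb t := (bb_abs t).trans (by norm_num)
  dif := dif_aux
  int := by rw [bd_int]; ring

lemma nice2 : Nice bb bd where
  F0 := bb_supp
  H0 := bd_supp
  Fm := bb_cont
  Hm := bd_cont
  Fb t := (bb_abs t).trans (by norm_num)
  Hb t := (bd_abs t).trans (by norm_num)
  dif u v u' v' := by
    have := dif_aux v u v' u'
    rw [mul_comm (bb u), mul_comm (bb u'), add_comm]; exact this
  int := by rw [bd_int]; ring
end

section

def cells (i : ℕ) : Finset (ℕ × ℕ) := Finset.range (2 ^ i) ×ˢ Finset.range (2 ^ i)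

lemma mem_cells {i : ℕ} {m : ℕ × ℕ} : m ∈ cells i ↔ m.1 < 2 ^ i ∧ m.2 < 2 ^ i := by
  simp [cells]

lemma card_cells (i : ℕ) : ((cells i).card : ℝ) = 4 ^ i := by
  simp only [cells, Finset.card_product, Finset.card_range]
  push_cast
  rw [← mul_pow]; norm_num

def lev (F H : ℝ → ℝ) (a : ℕ → ℕ × ℕ → ℝ) (i : ℕ) (s t : ℝ) : ℝ :=
  ∑ m ∈ cells i, a i m * (F (2 ^ i * s - m.1) * H (2 ^ i * t - m.2))

def GS (F H : ℝ → ℝ) (a : ℕ → ℕ × ℕ → ℝ) (j : ℕ) (s t : ℝ) : ℝ :=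
  ∑ i ∈ Finset.range j, lev F H a i s t

def inC (i : ℕ) (m : ℕ × ℕ) (s t : ℝ) : Prop :=
  (0 ≤ 2 ^ i * s - m.1 ∧ 2 ^ i * s - m.1 ≤ 1) ∧ (0 ≤ 2 ^ i * t - m.2 ∧ 2 ^ i * t - m.2 ≤ 1)

lemma supp_other {F : ℝ → ℝ} (hF : SuppU F) {x : ℝ} {m m' : ℕ} (h0 : 0 ≤ x - m) (h1 : x - m ≤ 1)
    (hne : m' ≠ m) : F (x - m') = 0 := by
  apply hF
  rcases lt_or_gt_of_ne hne with h | h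
  · right
    have : (m':ℝ) + 1 ≤ m := by exact_mod_cast h
    linarith
  · left
    have : (m:ℝ) + 1 ≤ m' := by exact_mod_cast h
    linarith

lemma lev_single {F H : ℝ → ℝ} (hF : SuppU F) (hH : SuppU H) (a : ℕ → ℕ × ℕ → ℝ) {i : ℕ} {m : ℕ × ℕ}
    (hm : m ∈ cells i) {s t : ℝ} (h : inC i m s t) :
    lev F H a i s t = a i m * (F (2 ^ i * s - m.1) * H (2 ^ i * t - m.2)) := by
  unfold lev
  apply Finset.sum_eq_single m
  · intro m' _ hne
    by_cases h1 : m'.1 = m.1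
    · have h2 : m'.2 ≠ m.2 := fun h2 => hne (Prod.ext h1 h2)
      rw [supp_other hH h.2.1 h.2.2 h2]; ring
    · rw [supp_other hF h.1.1 h.1.2 h1]; ring
  · intro h; exact absurd hm h

lemma lev_dich {F H : ℝ → ℝ} (hF : SuppU F) (hH : SuppU H) (a : ℕ → ℕ × ℕ → ℝ) (i : ℕ) (s t : ℝ) :
    lev F H a i s t = 0 ∨ ∃ m ∈ cells i, inC i m s t ∧
      lev F H a i s t = a i m * (F (2 ^ i * s - m.1) * H (2 ^ i * t - m.2)) := by
  by_cases h : ∃ m ∈ cells i, inC i m s t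
  · obtain ⟨m, hm, hc⟩ := h
    exact Or.inr ⟨m, hm, hc, lev_single hF hH a hm hc⟩
  · left
    push Not at h
    apply Finset.sum_eq_zero
    intro m hm
    have := h m hm
    by_contra hne
    apply this
    have hF1 : ¬ (2 ^ i * s - m.1 ≤ 0 ∨ 1 ≤ 2 ^ i * s - m.1) := fun h => hne (by rw [hF _ h]; ring)
    have hH1 : ¬ (2 ^ i * t - m.2 ≤ 0 ∨ 1 ≤ 2 ^ i * t - m.2) := fun h => hne (by rw [hH _ h]; ring)
    push Not at hF1 hH1
    exact ⟨⟨hF1.1.le, hF1.2.le⟩, ⟨hH1.1.le, hH1.2.le⟩⟩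

lemma prod_abs_le {F H : ℝ → ℝ} (N : Nice F H) (u v : ℝ) : |F u * H v| ≤ 1 := by
  rw [abs_mul]
  exact mul_le_one₀ (N.Fb u) (abs_nonneg _) (N.Hb v)

lemma term_abs_le {F H : ℝ → ℝ} (N : Nice F H) {c ε : ℝ} (hc : |c| ≤ ε) (u v : ℝ) : |c * (F u * H v)| ≤ ε := by
  rw [abs_mul]
  have := prod_abs_le N u v
  have := abs_nonneg c
  have := abs_nonneg (F u * H v)
  nlinarith

lemma lev_abs {F H : ℝ → ℝ} (N : Nice F H) {a : ℕ → ℕ × ℕ → ℝ} {ε : ℝ} (hε : 0 ≤ ε)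
    (ha : ∀ i m, |a i m| ≤ ε) (i : ℕ) (s t : ℝ) : |lev F H a i s t| ≤ ε := by
  rcases lev_dich N.F0 N.H0 a i s t with h | ⟨m, _, _, h⟩
  · rw [h]; simpa
  · rw [h]; exact term_abs_le N (ha i m) _ _

lemma anc1 {i j m : ℕ} (hij : i ≤ j) (hm : m < 2 ^ j) : m / 2 ^ (j - i) < 2 ^ i := by
  rw [Nat.div_lt_iff_lt_mul (by positivity), ← pow_add, Nat.add_sub_cancel' hij]; exact hm

lemma anc2 {i j m : ℕ} (hij : i ≤ j) {s : ℝ} (h : 0 ≤ 2 ^ j * s - m ∧ 2 ^ j * s - m ≤ 1) :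
    0 ≤ 2 ^ i * s - (m / 2 ^ (j - i) : ℕ) ∧ 2 ^ i * s - (m / 2 ^ (j - i) : ℕ) ≤ 1 := by
  obtain ⟨k, rfl⟩ := Nat.exists_eq_add_of_le hij
  rw [Nat.add_sub_cancel_left]
  have a1 : m / 2 ^ k * 2 ^ k ≤ m := Nat.div_mul_le_self _ _
  have a2 : m + 1 ≤ (m / 2 ^ k + 1) * 2 ^ k := Nat.lt_mul_of_div_lt (Nat.lt_succ_self _) (by positivity)
  have b1 : ((m / 2 ^ k : ℕ):ℝ) * 2 ^ k ≤ m := by exact_mod_cast a1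
  have b2 : (m:ℝ) + 1 ≤ ((m / 2 ^ k : ℕ) + 1) * 2 ^ k := by exact_mod_cast a2
  rw [pow_add] at h
  have hk : (0:ℝ) < 2 ^ k := by positivity
  constructor
  · by_contra hc
    push Not at hc
    nlinarith [mul_lt_mul_of_pos_right hc hk]
  · by_contra hc
    push Not at hc
    nlinarith [mul_lt_mul_of_pos_right hc hk]

lemma lev_osc {F H : ℝ → ℝ} (N : Nice F H) {a : ℕ → ℕ × ℕ → ℝ} {ε : ℝ} (hε : 0 ≤ ε)
    (ha : ∀ i m, |a i m| ≤ ε) {i j : ℕ} (hij : i ≤ j) {m : ℕ × ℕ} (hm : m ∈ cells j) {s t s' t' : ℝ}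
    (h : inC j m s t) (h' : inC j m s' t') :
    |lev F H a i s t - lev F H a i s' t'| ≤ ε * (2 ^ i / 2 ^ j) / 2 := by
  have hm' := mem_cells.1 hm
  have hma : (m.1 / 2 ^ (j - i), m.2 / 2 ^ (j - i)) ∈ cells i := mem_cells.2 ⟨anc1 hij hm'.1, anc1 hij hm'.2⟩
  rw [lev_single N.F0 N.H0 a hma ⟨anc2 hij h.1, anc2 hij h.2⟩,
    lev_single N.F0 N.H0 a hma ⟨anc2 hij h'.1, anc2 hij h'.2⟩, ← mul_sub, abs_mul]
  have hd := N.dif (2 ^ i * s - (m.1 / 2 ^ (j - i) : ℕ)) (2 ^ i * t - (m.2 / 2 ^ (j - i) : ℕ))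
    (2 ^ i * s' - (m.1 / 2 ^ (j - i) : ℕ)) (2 ^ i * t' - (m.2 / 2 ^ (j - i) : ℕ))
  have hpi : (0:ℝ) < 2 ^ i := by positivity
  have hpj : (0:ℝ) < 2 ^ j := by positivity
  have e : ∀ s s' : ℝ, ∀ k k' : ℕ, 0 ≤ 2 ^ j * s - k ∧ 2 ^ j * s - k ≤ 1 → 0 ≤ 2 ^ j * s' - k ∧ 2 ^ j * s' - k ≤ 1 →
      |2 ^ i * s - k' - (2 ^ i * s' - k')| ≤ (2:ℝ) ^ i / 2 ^ j := by
    intro s s' k k' h h'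
    rw [show 2 ^ i * s - k' - (2 ^ i * s' - k') = (2:ℝ) ^ i / 2 ^ j * (2 ^ j * s - 2 ^ j * s') by field_simp; ring, abs_mul,
      abs_of_pos (by positivity)]
    have : |2 ^ j * s - 2 ^ j * s'| ≤ 1 := by rw [abs_le]; constructor <;> linarith [h.1, h.2, h'.1, h'.2]
    have : (0:ℝ) < 2 ^ i / 2 ^ j := by positivity
    nlinarith
  have e1 := e s s' m.1 (m.1 / 2 ^ (j - i)) h.1 h'.1
  have e2 := e t t' m.2 (m.2 / 2 ^ (j - i)) h.2 h'.2
  refine (mul_le_mul (ha _ _) hd (abs_nonneg _) hε).trans ?_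
  rw [mul_div_assoc]
  exact mul_le_mul_of_nonneg_left (by linarith) hε

lemma GS_osc {F H : ℝ → ℝ} (N : Nice F H) {a : ℕ → ℕ × ℕ → ℝ} {ε : ℝ} (hε : 0 ≤ ε)
    (ha : ∀ i m, |a i m| ≤ ε) {j : ℕ} {m : ℕ × ℕ} (hm : m ∈ cells j) {s t s' t' : ℝ}
    (h : inC j m s t) (h' : inC j m s' t') :
    |GS F H a j s t - GS F H a j s' t'| ≤ ε := by
  unfold GS
  rw [← Finset.sum_sub_distrib]
  refine (Finset.abs_sum_le_sum_abs _ _).trans ?_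
  refine (Finset.sum_le_sum fun i hi => lev_osc N hε ha (Finset.mem_range.1 hi).le hm h h').trans ?_
  have hs : ∑ i ∈ Finset.range j, (2:ℝ) ^ i ≤ 2 ^ j := by
    rw [geom_sum_eq (by norm_num)]; norm_num
  have hpj : (0:ℝ) < 2 ^ j := by positivity
  rw [← Finset.sum_div, ← Finset.mul_sum, ← Finset.sum_div]
  have : (∑ i ∈ Finset.range j, (2:ℝ) ^ i) / 2 ^ j ≤ 1 := by rw [div_le_one hpj]; exact hs
  nlinarith

def ctr (j m : ℕ) : ℝ := (m + 1 / 2) / 2 ^ j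

lemma ctr_in (j : ℕ) (m : ℕ × ℕ) : inC j m (ctr j m.1) (ctr j m.2) := by
  have e : ∀ k : ℕ, 2 ^ j * ctr j k - k = (1 / 2 : ℝ) := by
    intro k; unfold ctr; field_simp; ring
  unfold inC; rw [e, e]; norm_num

lemma GS_bound {F H : ℝ → ℝ} (N : Nice F H) {a : ℕ → ℕ × ℕ → ℝ} {ε M : ℝ} (hε : 0 ≤ ε) (hM : 0 ≤ M)
    (ha : ∀ i m, |a i m| ≤ ε)
    (hst : ∀ j, ∀ m ∈ cells j, a j m = 0 ∨ |GS F H a j (ctr j m.1) (ctr j m.2)| ≤ M) (j : ℕ) (s t : ℝ) :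
    |GS F H a j s t| ≤ M + 2 * ε := by
  induction j with
  | zero => simp [GS]; linarith
  | succ j ih =>
    have e : GS F H a (j + 1) s t = GS F H a j s t + lev F H a j s t := Finset.sum_range_succ _ _
    rw [e]
    rcases lev_dich N.F0 N.H0 a j s t with h | ⟨m, hm, hc, h⟩
    · rw [h, add_zero]; exact ih
    · rcases hst j m hm with h0 | h0
      · rw [h, h0, zero_mul, add_zero]; exact ih
      · have h1 := GS_osc N hε ha hm hc (ctr_in j m)
        have h2 := lev_abs N hε ha j s t
        rw [abs_le] at *
        constructor <;> linarith [h0.1, h0.2, h1.1, h1.2, h2.1, h2.2]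
end

section

lemma cell_in_unit {i k : ℕ} (hk : k < 2 ^ i) {s : ℝ} (h : 0 < 2 ^ i * s - k ∧ 2 ^ i * s - k < 1) :
    0 ≤ s ∧ s ≤ 1 := by
  have hp : (0:ℝ) < 2 ^ i := by positivity
  have hk' : (k:ℝ) + 1 ≤ 2 ^ i := by exact_mod_cast hk
  have hk0 : (0:ℝ) ≤ k := by positivity
  constructor
  · by_contra hc; push Not at hc; nlinarith
  · by_contra hc; push Not at hc; nlinarith

lemma int_affine (F : ℝ → ℝ) (i k : ℕ) : ∫ s, F (2 ^ i * s - k) = ((2:ℝ) ^ i)⁻¹ * ∫ t, F t := by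
  have h1 := Measure.integral_comp_mul_left (fun t => F (t - k)) ((2:ℝ) ^ i)
  rw [h1, integral_sub_right_eq_self (fun t => F t) (k:ℝ), abs_of_pos (by positivity), smul_eq_mul]

lemma int_tm {F H : ℝ → ℝ} (hF : SuppU F) (hH : SuppU H) {i : ℕ} {m : ℕ × ℕ} (hm : m ∈ cells i) :
    ∫ x, F (2 ^ i * x 0 - m.1) * H (2 ^ i * x 1 - m.2) ∂uniformSquare
      = ((4:ℝ) ^ i)⁻¹ * ((∫ t, F t) * ∫ t, H t) := by
  unfold uniformSquare
  rw [setIntegral_eq_integral_of_forall_compl_eq_zero]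
  · have h := integral_fintype_prod_volume_eq_prod (ι := Fin 2) (E := fun _ => ℝ)
      (![fun s => F (2 ^ i * s - m.1), fun s => H (2 ^ i * s - m.2)])
    simp only [Fin.prod_univ_two, Matrix.cons_val_zero, Matrix.cons_val_one] at h
    rw [h, int_affine, int_affine]
    have e4 : (4:ℝ) ^ i = 2 ^ i * 2 ^ i := by rw [← mul_pow]; norm_num
    rw [e4, mul_inv]; ring
  · intro x hx
    by_contra hne
    apply hx
    have hF1 : ¬ (2 ^ i * x 0 - m.1 ≤ 0 ∨ 1 ≤ 2 ^ i * x 0 - m.1) := fun h => hne (by rw [hF _ h]; ring)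
    have hH1 : ¬ (2 ^ i * x 1 - m.2 ≤ 0 ∨ 1 ≤ 2 ^ i * x 1 - m.2) := fun h => hne (by rw [hH _ h]; ring)
    push Not at hF1 hH1
    have hm' := mem_cells.1 hm
    intro k
    fin_cases k
    · exact cell_in_unit hm'.1 hF1
    · exact cell_in_unit hm'.2 hH1

def I01 : ℝ → ℝ := (Set.Ioo (0:ℝ) 1).indicator (fun _ => 1)
lemma I01_supp : SuppU I01 := by
  intro t ht
  unfold I01
  rw [Set.indicator_of_notMem]
  rintro ⟨h1, h2⟩
  rcases ht with h | h <;> linarith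
lemma I01_int : ∫ t, I01 t = 1 := by
  unfold I01
  rw [integral_indicator_const _ measurableSet_Ioo]
  simp
lemma I01_meas : Measurable I01 := measurable_const.indicator measurableSet_Ioo
lemma I01_nonneg (t : ℝ) : 0 ≤ I01 t := Set.indicator_nonneg (fun _ _ => zero_le_one) _
lemma I01_le (t : ℝ) : I01 t ≤ 1 := Set.indicator_le_self' (fun _ _ => zero_le_one) _
lemma I01_of_mem {t : ℝ} (h0 : 0 < t) (h1 : t < 1) : I01 t = 1 := Set.indicator_of_mem (show t ∈ Set.Ioo (0:ℝ) 1 from ⟨h0, h1⟩) _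

lemma lev_cont {F H : ℝ → ℝ} (N : Nice F H) (a : ℕ → ℕ × ℕ → ℝ) (i : ℕ) :
    Continuous (fun x : Fin 2 → ℝ => lev F H a i (x 0) (x 1)) := by
  have := N.Fm
  have := N.Hm
  unfold lev; fun_prop

lemma GS_cont {F H : ℝ → ℝ} (N : Nice F H) (a : ℕ → ℕ × ℕ → ℝ) (j : ℕ) :
    Continuous (fun x : Fin 2 → ℝ => GS F H a j (x 0) (x 1)) := by
  unfold GS
  exact continuous_finsetSum _ fun i _ => lev_cont N a i

lemma cont_int {f : (Fin 2 → ℝ) → ℝ} (hf : Continuous f) : Integrable f uniformSquare := by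
  unfold uniformSquare
  rw [unitSquare_eq]
  exact hf.continuousOn.integrableOn_compact isCompact_Icc

lemma I01_tm_int (i : ℕ) (m : ℕ × ℕ) (c : ℝ) :
    Integrable (fun x : Fin 2 → ℝ => c * (I01 (2 ^ i * x 0 - m.1) * I01 (2 ^ i * x 1 - m.2))) uniformSquare := by
  refine Integrable.const_mul ?_ c
  refine Integrable.of_bound (Measurable.aestronglyMeasurable ?_) 1 (Filter.Eventually.of_forall fun x => ?_)
  · have := I01_meas
    fun_prop
  · rw [Real.norm_eq_abs, abs_of_nonneg (mul_nonneg (I01_nonneg _) (I01_nonneg _))]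
    exact mul_le_one₀ (I01_le _) (I01_nonneg _) (I01_le _)

lemma cross_bound {F H : ℝ → ℝ} (N : Nice F H) {a : ℕ → ℕ × ℕ → ℝ} {ε : ℝ} (hε : 0 ≤ ε)
    (ha : ∀ i m, |a i m| ≤ ε) (j : ℕ) :
    ∫ x, GS F H a j (x 0) (x 1) * lev F H a j (x 0) (x 1) ∂uniformSquare ≤ ε ^ 2 := by
  have hFc := N.Fm
  have hHc := N.Hm
  have hGc := GS_cont N a j
  have e1 : ∀ x : Fin 2 → ℝ, GS F H a j (x 0) (x 1) * lev F H a j (x 0) (x 1) =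
      ∑ m ∈ cells j, GS F H a j (x 0) (x 1) * (a j m * (F (2 ^ j * x 0 - m.1) * H (2 ^ j * x 1 - m.2))) := by
    intro x; rw [lev, Finset.mul_sum]
  simp_rw [e1]
  rw [integral_finsetSum _ fun m _ => cont_int (by fun_prop)]
  have h1 : ∀ m ∈ cells j, ∫ x, GS F H a j (x 0) (x 1) *
      (a j m * (F (2 ^ j * x 0 - m.1) * H (2 ^ j * x 1 - m.2))) ∂uniformSquare ≤ ε ^ 2 * ((4:ℝ) ^ j)⁻¹ := by
    intro m hm
    set g := GS F H a j (ctr j m.1) (ctr j m.2)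
    have e2 : ∫ x, g * a j m * (F (2 ^ j * x 0 - m.1) * H (2 ^ j * x 1 - m.2)) ∂uniformSquare = 0 := by
      rw [integral_const_mul, int_tm N.F0 N.H0 hm, N.int]; ring
    rw [← sub_zero (∫ x, _ ∂uniformSquare), ← e2, ← integral_sub (cont_int (by fun_prop)) (cont_int (by fun_prop))]
    have e3 : ∫ x, ε ^ 2 * (I01 (2 ^ j * x 0 - m.1) * I01 (2 ^ j * x 1 - m.2)) ∂uniformSquare = ε ^ 2 * ((4:ℝ) ^ j)⁻¹ := by
      rw [integral_const_mul, int_tm I01_supp I01_supp hm, I01_int]; ring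
    rw [← e3]
    refine integral_mono (cont_int (by fun_prop)) (I01_tm_int _ _ _) fun x => ?_
    simp only
    by_cases hF : 2 ^ j * x 0 - m.1 ≤ 0 ∨ 1 ≤ 2 ^ j * x 0 - m.1
    · rw [N.F0 _ hF, I01_supp _ hF]; simp
    by_cases hH : 2 ^ j * x 1 - m.2 ≤ 0 ∨ 1 ≤ 2 ^ j * x 1 - m.2
    · rw [N.H0 _ hH, I01_supp _ hH]; simp
    push Not at hF hH
    rw [I01_of_mem hF.1 hF.2, I01_of_mem hH.1 hH.2]
    have ho := GS_osc N hε ha hm (s := x 0) (t := x 1) ⟨⟨hF.1.le, hF.2.le⟩, ⟨hH.1.le, hH.2.le⟩⟩ (ctr_in j m)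
    have ht := term_abs_le N (ha j m) (2 ^ j * x 0 - m.1) (2 ^ j * x 1 - m.2)
    calc _ = (GS F H a j (x 0) (x 1) - g) * (a j m * (F (2 ^ j * x 0 - m.1) * H (2 ^ j * x 1 - m.2))) := by ring
      _ ≤ |(GS F H a j (x 0) (x 1) - g) * (a j m * (F (2 ^ j * x 0 - m.1) * H (2 ^ j * x 1 - m.2)))| := le_abs_self _
      _ ≤ ε * ε := by rw [abs_mul]; exact mul_le_mul ho ht (abs_nonneg _) hε
      _ = _ := by ring
  refine (Finset.sum_le_sum h1).trans (le_of_eq ?_)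
  rw [Finset.sum_const, nsmul_eq_mul, card_cells]
  field_simp

lemma GS_energy {F H : ℝ → ℝ} (N : Nice F H) {a : ℕ → ℕ × ℕ → ℝ} {ε : ℝ} (hε : 0 ≤ ε)
    (ha : ∀ i m, |a i m| ≤ ε) (j : ℕ) :
    ∫ x, GS F H a j (x 0) (x 1) ^ 2 ∂uniformSquare ≤ 3 * j * ε ^ 2 := by
  induction j with
  | zero => simp [GS]
  | succ j ih =>
    have hGc := GS_cont N a j
    have hlc := lev_cont N a j
    have e : ∀ x : Fin 2 → ℝ, GS F H a (j + 1) (x 0) (x 1) ^ 2 =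
      GS F H a j (x 0) (x 1) ^ 2 + (2 * (GS F H a j (x 0) (x 1) * lev F H a j (x 0) (x 1))
        + lev F H a j (x 0) (x 1) ^ 2) := by
      intro x
      have e : GS F H a (j + 1) (x 0) (x 1) = GS F H a j (x 0) (x 1) + lev F H a j (x 0) (x 1) := Finset.sum_range_succ _ _
      rw [e]; ring
    simp_rw [e]
    rw [integral_add (cont_int (by fun_prop)) (cont_int (by fun_prop)),
      integral_add (cont_int (by fun_prop)) (cont_int (by fun_prop)), integral_const_mul]
    have h2 := cross_bound N hε ha j
    have h3 : ∫ x, lev F H a j (x 0) (x 1) ^ 2 ∂uniformSquare ≤ ε ^ 2 := by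
      calc _ ≤ ∫ _, ε ^ 2 ∂uniformSquare := by
            refine integral_mono (cont_int (by fun_prop)) (integrable_const _) fun x => ?_
            simp only
            rw [← sq_abs]
            exact pow_le_pow_left₀ (abs_nonneg _) (lev_abs N hε ha j _ _) 2
        _ = ε ^ 2 := by simp
    push_cast
    linarith
end

section

def aco (z : ℕ → ℕ × ℕ → ℝ) (M : ℝ) (j : ℕ) (m : ℕ × ℕ) : ℝ :=
  if |∑ i : Fin j, ∑ m' ∈ cells i.1, aco z M i.1 m' *
      (bd (2 ^ i.1 * ctr j m.1 - m'.1) * bb (2 ^ i.1 * ctr j m.2 - m'.2))| ≤ M ∧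
    |∑ i : Fin j, ∑ m' ∈ cells i.1, aco z M i.1 m' *
      (bb (2 ^ i.1 * ctr j m.1 - m'.1) * bd (2 ^ i.1 * ctr j m.2 - m'.2))| ≤ M then z j m else 0
termination_by j
decreasing_by all_goals exact i.2

lemma aco_eq (z : ℕ → ℕ × ℕ → ℝ) (M : ℝ) (j : ℕ) (m : ℕ × ℕ) :
    aco z M j m = if |GS bd bb (aco z M) j (ctr j m.1) (ctr j m.2)| ≤ M ∧
      |GS bb bd (aco z M) j (ctr j m.1) (ctr j m.2)| ≤ M then z j m else 0 := by
  rw [aco]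
  simp only [GS, lev, Finset.sum_range]

/-- number of stopped cells -/
lemma stopped_count {a : ℕ → ℕ × ℕ → ℝ} {ε M : ℝ} (hε : 0 ≤ ε) (hε1 : ε ≤ 1) (hM : 1 ≤ M)
    (ha : ∀ i m, |a i m| ≤ ε) (j : ℕ) (hj : j * ε ^ 2 ≤ 1) (T : Finset (ℕ × ℕ)) (hT : T ⊆ cells j)
    (hst : ∀ m ∈ T, M < |GS bd bb a j (ctr j m.1) (ctr j m.2)| ∨ M < |GS bb bd a j (ctr j m.1) (ctr j m.2)|) :
    T.card * (M - 1) ^ 2 ≤ 6 * 4 ^ j := by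
  classical
  let st : ℕ → ℕ × ℕ → ℝ := fun _ m => if m ∈ T then (M - 1) ^ 2 else 0
  have hpt : ∀ x : Fin 2 → ℝ, lev I01 I01 st j (x 0) (x 1) ≤
      GS bd bb a j (x 0) (x 1) ^ 2 + GS bb bd a j (x 0) (x 1) ^ 2 := by
    intro x
    rcases lev_dich I01_supp I01_supp st j (x 0) (x 1) with h | ⟨m, hm, hc, h⟩
    · rw [h]; positivity
    · rw [h]
      by_cases hmT : m ∈ T
      · simp only [st, if_pos hmT]
        have hI : I01 (2 ^ j * x 0 - m.1) * I01 (2 ^ j * x 1 - m.2) ≤ 1 := mul_le_one₀ (I01_le _) (I01_nonneg _) (I01_le _)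
        have h1 : (M - 1) ^ 2 * (I01 (2 ^ j * x 0 - m.1) * I01 (2 ^ j * x 1 - m.2)) ≤ (M - 1) ^ 2 :=
          mul_le_of_le_one_right (sq_nonneg _) hI
        have key : ∀ F H, Nice F H → M < |GS F H a j (ctr j m.1) (ctr j m.2)| →
            (M - 1) ^ 2 ≤ GS F H a j (x 0) (x 1) ^ 2 := by
          intro F H N h
          have ho := GS_osc N hε ha hm (ctr_in j m) hc
          have : M - 1 ≤ |GS F H a j (x 0) (x 1)| := by
            have := abs_sub_abs_le_abs_sub (GS F H a j (ctr j m.1) (ctr j m.2)) (GS F H a j (x 0) (x 1))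
            linarith
          rw [← sq_abs (GS F H a j (x 0) (x 1))]
          exact pow_le_pow_left₀ (by linarith) this 2
        rcases hst m hmT with h | h
        · have := key _ _ nice1 h
          have := sq_nonneg (GS bb bd a j (x 0) (x 1))
          linarith
        · have := key _ _ nice2 h
          have := sq_nonneg (GS bd bb a j (x 0) (x 1))
          linarith
      · simp only [st, if_neg hmT, zero_mul]; positivity
  have c1 := GS_cont nice1 a j
  have c2 := GS_cont nice2 a j
  have hint : ∫ x, lev I01 I01 st j (x 0) (x 1) ∂uniformSquare = T.card * (M - 1) ^ 2 * ((4:ℝ) ^ j)⁻¹ := by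
    unfold lev
    rw [integral_finsetSum _ fun m _ => I01_tm_int j m (st j m)]
    have : ∀ m ∈ cells j, ∫ x, st j m * (I01 (2 ^ j * x 0 - m.1) * I01 (2 ^ j * x 1 - m.2)) ∂uniformSquare
        = if m ∈ T then (M - 1) ^ 2 * ((4:ℝ) ^ j)⁻¹ else 0 := by
      intro m hm
      rw [integral_const_mul, int_tm I01_supp I01_supp hm, I01_int]
      simp only [st]
      split_ifs <;> ring
    rw [Finset.sum_congr rfl this, ← Finset.sum_filter, Finset.sum_const, nsmul_eq_mul,
      Finset.filter_mem_eq_inter, Finset.inter_eq_right.2 hT]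
    ring
  have hle : ∫ x, lev I01 I01 st j (x 0) (x 1) ∂uniformSquare ≤
      ∫ x, (GS bd bb a j (x 0) (x 1) ^ 2 + GS bb bd a j (x 0) (x 1) ^ 2) ∂uniformSquare := by
    refine integral_mono ?_ (cont_int (by fun_prop)) hpt
    unfold lev
    exact integrable_finsetSum _ fun m _ => I01_tm_int j m (st j m)
  rw [hint, integral_add (cont_int (by fun_prop)) (cont_int (by fun_prop))] at hle
  have g1 := GS_energy nice1 hε ha j
  have g2 := GS_energy nice2 hε ha j
  have h6 : T.card * (M - 1) ^ 2 * ((4:ℝ) ^ j)⁻¹ ≤ 6 := by linarith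
  rwa [← div_eq_mul_inv, div_le_iff₀ (by positivity)] at h6

def fS (a : ℕ → ℕ × ℕ → ℝ) (r : ℕ) (s t : ℝ) : ℝ :=
  ∑ i ∈ Finset.range r, ∑ m ∈ cells i, a i m * (((2:ℝ) ^ i)⁻¹ * (bb (2 ^ i * s - m.1) * bb (2 ^ i * t - m.2)))

lemma bb_aff (i : ℕ) (k s : ℝ) : HasDerivAt (fun s => ((2:ℝ) ^ i)⁻¹ * bb (2 ^ i * s - k)) (bd (2 ^ i * s - k)) s := by
  have h1 : HasDerivAt (fun s : ℝ => 2 ^ i * s - k) (2 ^ i) s := by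
    simpa using ((hasDerivAt_id s).const_mul ((2:ℝ) ^ i)).sub_const k
  have h2 := ((bb_deriv (2 ^ i * s - k)).comp s h1).const_mul ((2:ℝ) ^ i)⁻¹
  refine h2.congr_deriv ?_
  field_simp

lemma fS_deriv1 (a : ℕ → ℕ × ℕ → ℝ) (r : ℕ) (s t : ℝ) :
    HasDerivAt (fun s => fS a r s t) (GS bd bb a r s t) s := by
  unfold fS GS lev
  refine HasDerivAt.fun_sum fun i _ => HasDerivAt.fun_sum fun m _ => ?_
  have := ((bb_aff i m.1 s).mul_const (bb (2 ^ i * t - m.2))).const_mul (a i m)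
  refine this.congr_of_eventuallyEq (Filter.Eventually.of_forall fun u => ?_)
  simp only; ring

lemma fS_deriv2 (a : ℕ → ℕ × ℕ → ℝ) (r : ℕ) (s t : ℝ) :
    HasDerivAt (fun t => fS a r s t) (GS bb bd a r s t) t := by
  unfold fS GS lev
  refine HasDerivAt.fun_sum fun i _ => HasDerivAt.fun_sum fun m _ => ?_
  have := ((bb_aff i m.2 t).const_mul (bb (2 ^ i * s - m.1))).const_mul (a i m)
  refine this.congr_of_eventuallyEq (Filter.Eventually.of_forall fun u => ?_)
  simp only; ring

lemma mvt {f g : ℝ → ℝ} {K : ℝ} (h : ∀ s, HasDerivAt f (g s) s) (hg : ∀ s, |g s| ≤ K) (x y : ℝ) :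
    |f x - f y| ≤ K * |x - y| := by
  have := Convex.norm_image_sub_le_of_norm_hasDerivWithin_le (f := f) (f' := g) (C := K) (s := Set.univ)
    (x := y) (y := x) (fun s _ => (h s).hasDerivWithinAt) (fun s _ => hg s) convex_univ trivial trivial
  simpa using this

lemma lower_det {ε M : ℝ} (hε : 0 ≤ ε) (hε1 : ε ≤ 1) (hM : 1 ≤ M) (r : ℕ) (hr : r * ε ^ 2 ≤ 1)
    (z : ℕ → ℕ × ℕ → ℝ) (hz : ∀ i m, |z i m| ≤ ε) :
    ∃ (a : ℕ → ℕ × ℕ → ℝ) (T : ℕ → Finset (ℕ × ℕ)), (∀ i, T i ⊆ cells i) ∧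
      (∀ i, ∀ m ∈ cells i, a i m = if m ∈ T i then 0 else z i m) ∧
      (∀ i < r, (T i).card * (M - 1) ^ 2 ≤ 6 * 4 ^ i) ∧
      ∀ s t s' t', |fS a r s t - fS a r s' t'| ≤ (M + 2) * (|s - s'| + |t - t'|) := by
  classical
  set a := aco z M with hadef
  have ha : ∀ i m, |a i m| ≤ ε := by
    intro i m
    rw [hadef, aco_eq]
    split_ifs
    · exact hz i m
    · simpa
  let T : ℕ → Finset (ℕ × ℕ) := fun i => (cells i).filter fun m =>
    ¬ (|GS bd bb a i (ctr i m.1) (ctr i m.2)| ≤ M ∧ |GS bb bd a i (ctr i m.1) (ctr i m.2)| ≤ M)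
  refine ⟨a, T, fun i => Finset.filter_subset _ _, ?_, ?_, ?_⟩
  · intro i m hm
    rw [hadef, aco_eq]
    simp only [T, Finset.mem_filter, hm, true_and, ite_not, ← hadef]
  · intro i hi
    refine stopped_count hε hε1 hM ha i ?_ (T i) (Finset.filter_subset _ _) ?_
    · have : (i:ℝ) ≤ r := by exact_mod_cast hi.le
      nlinarith [sq_nonneg ε]
    · intro m hm
      have := (Finset.mem_filter.1 hm).2
      rw [not_and_or, not_le, not_le] at this
      exact this
  · intro s t s' t'
    have b1 := GS_bound nice1 hε (by linarith : 0 ≤ M) ha (fun j m _ => by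
      by_cases h : |GS bd bb a j (ctr j m.1) (ctr j m.2)| ≤ M
      · exact Or.inr h
      · left; rw [hadef, aco_eq, if_neg]; rw [← hadef]; tauto) r
    have b2 := GS_bound nice2 hε (by linarith : 0 ≤ M) ha (fun j m _ => by
      by_cases h : |GS bb bd a j (ctr j m.1) (ctr j m.2)| ≤ M
      · exact Or.inr h
      · left; rw [hadef, aco_eq, if_neg]; rw [← hadef]; tauto) r
    have m1 := mvt (fun u => fS_deriv1 a r u t) (fun u => (b1 u t).trans (by linarith : M + 2 * ε ≤ M + 2)) s s'
    have m2 := mvt (fun u => fS_deriv2 a r s' u) (fun u => (b2 s' u).trans (by linarith : M + 2 * ε ≤ M + 2)) t t'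
    have := abs_sub_le (fS a r s t) (fS a r s' t) (fS a r s' t')
    linarith
end

section

lemma bb_int : ∫ t, bb t = 1 / 30 := by
  rw [int_supp bb_supp]
  have : ∫ t in (0:ℝ)..1, bb t = ∫ t in (0:ℝ)..1, (t ^ 2 - 2 * t ^ 3 + t ^ 4) := by
    apply intervalIntegral.integral_congr
    intro t ht
    rw [Set.uIcc_of_le zero_le_one] at ht
    simp only [bb, pp_mid ht.1 ht.2]; ring
  rw [this]
  rw [intervalIntegral.integral_add, intervalIntegral.integral_sub, intervalIntegral.integral_const_mul]
  · simp only [integral_pow]; norm_num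
  all_goals exact Continuous.intervalIntegrable (by fun_prop) _ _

lemma bb2_supp : SuppU (fun t => bb t ^ 2) := by
  intro t ht; simp only [bb_supp t ht]; norm_num

lemma bb2_int : ∫ t, bb t ^ 2 = 1 / 630 := by
  rw [int_supp bb2_supp]
  have : ∫ t in (0:ℝ)..1, bb t ^ 2 = ∫ t in (0:ℝ)..1, (t ^ 4 - 4 * t ^ 5 + 6 * t ^ 6 - 4 * t ^ 7 + t ^ 8) := by
    apply intervalIntegral.integral_congr
    intro t ht
    rw [Set.uIcc_of_le zero_le_one] at ht
    simp only [bb, pp_mid ht.1 ht.2]; ring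
  rw [this]
  rw [intervalIntegral.integral_add, intervalIntegral.integral_sub, intervalIntegral.integral_add,
    intervalIntegral.integral_sub, intervalIntegral.integral_const_mul, intervalIntegral.integral_const_mul,
    intervalIntegral.integral_const_mul]
  · simp only [integral_pow]; norm_num
  all_goals exact Continuous.intervalIntegrable (by fun_prop) _ _

def hh (i : ℕ) (m : ℕ × ℕ) (x : Fin 2 → ℝ) : ℝ :=
  ((2:ℝ) ^ i)⁻¹ * (bb (2 ^ i * x 0 - m.1) * bb (2 ^ i * x 1 - m.2))

lemma hh_meas (i : ℕ) (m : ℕ × ℕ) : Measurable (hh i m) := by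
  have := bb_cont
  have : Continuous (hh i m) := by unfold hh; fun_prop
  exact this.measurable

lemma hh_abs (i : ℕ) (m : ℕ × ℕ) (x) : |hh i m x| ≤ ((2:ℝ) ^ i)⁻¹ := by
  unfold hh
  rw [abs_mul, abs_of_pos (by positivity), abs_mul]
  apply mul_le_of_le_one_right (by positivity)
  exact mul_le_one₀ ((bb_abs _).trans (by norm_num)) (abs_nonneg _) ((bb_abs _).trans (by norm_num))

lemma hh_int {i : ℕ} {m : ℕ × ℕ} (hm : m ∈ cells i) :
    ∫ x, hh i m x ∂uniformSquare = ((2:ℝ) ^ i)⁻¹ * (((4:ℝ) ^ i)⁻¹ * (1 / 30 * (1 / 30))) := by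
  unfold hh
  rw [integral_const_mul, int_tm bb_supp bb_supp hm, bb_int]

lemma hh2_int {i : ℕ} {m : ℕ × ℕ} (hm : m ∈ cells i) :
    ∫ x, hh i m x ^ 2 ∂uniformSquare = ((4:ℝ) ^ i)⁻¹ * (((4:ℝ) ^ i)⁻¹ * (1 / 630 * (1 / 630))) := by
  have e4 : (4:ℝ) ^ i = 2 ^ i * 2 ^ i := by rw [← mul_pow]; norm_num
  have e : ∀ x, hh i m x ^ 2 = ((4:ℝ) ^ i)⁻¹ * (bb (2 ^ i * x 0 - m.1) ^ 2 * bb (2 ^ i * x 1 - m.2) ^ 2) := by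
    intro x; unfold hh; rw [e4, mul_inv]; ring
  simp_rw [e]
  rw [integral_const_mul, int_tm bb2_supp bb2_supp hm, bb2_int]

variable {n : ℕ} {Ω : Type} [MeasurableSpace Ω] {P : Measure Ω} {X Y : Fin n → Ω → (Fin 2 → ℝ)}

lemma lower_pt (hn : 0 < n) {ε M : ℝ} (hε : 0 ≤ ε) (hε1 : ε ≤ 1) (hM : 1 < M) (r : ℕ) (hr : r * ε ^ 2 ≤ 1)
    (τ : ℕ → ℝ) (hτ : ∀ i, 0 < τ i) (ω : Ω) :
    ε * ∑ i ∈ Finset.range r, (∑ m ∈ cells i, (|Dsum X Y (hh i m) ω| - Dsum X Y (hh i m) ω ^ 2 / (4 * τ i))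
      - τ i * (6 * 4 ^ i / (M - 1) ^ 2)) ≤
    2 * (M + 2) * (n * matchingCost (fun k => X k ω) (fun k => Y k ω)) := by
  classical
  let D : ℕ → ℕ × ℕ → ℝ := fun i m => Dsum X Y (hh i m) ω
  let z : ℕ → ℕ × ℕ → ℝ := fun i m => if 0 ≤ D i m then ε else -ε
  have hz : ∀ i m, |z i m| ≤ ε := by
    intro i m; simp only [z]; split_ifs
    · rw [abs_of_nonneg hε]
    · rw [abs_neg, abs_of_nonneg hε]
  have hzD : ∀ i m, z i m * D i m = ε * |D i m| := by
    intro i m; simp only [z]; split_ifs with h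
    · rw [abs_of_nonneg h]
    · rw [abs_of_neg (not_le.1 h)]; ring
  obtain ⟨a, T, hTs, haz, hcard, hlip⟩ := lower_det hε hε1 hM.le r hr z hz
  let f : (Fin 2 → ℝ) → ℝ := fun x => fS a r (x 0) (x 1)
  have hf : ∀ x y, f x - f y ≤ 2 * (M + 2) * euclidDist2 x y := by
    intro x y
    have h1 := (le_abs_self _).trans (hlip (x 0) (x 1) (y 0) (y 1))
    have h2 := le_ed x y
    have : (M + 2) * (|x 0 - y 0| + |x 1 - y 1|) ≤ (M + 2) * (2 * euclidDist2 x y) :=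
      mul_le_mul_of_nonneg_left h2 (by linarith)
    simp only [f]; linarith
  refine le_trans ?_ (mc_ge hn _ _ (2 * (M + 2)) (by linarith) f hf)
  have hsum : ∀ Z : Fin n → (Fin 2 → ℝ), ∑ k, f (Z k) =
      ∑ i ∈ Finset.range r, ∑ m ∈ cells i, a i m * ∑ k, hh i m (Z k) := by
    intro Z
    simp only [f, fS]
    rw [Finset.sum_comm]
    refine Finset.sum_congr rfl fun i _ => ?_
    rw [Finset.sum_comm]
    refine Finset.sum_congr rfl fun m _ => ?_
    rw [Finset.mul_sum]
    rfl
  rw [hsum, hsum, ← Finset.sum_sub_distrib, Finset.mul_sum]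
  refine Finset.sum_le_sum fun i hi => ?_
  rw [← Finset.sum_sub_distrib]
  have e1 : ∀ m ∈ cells i, a i m * ∑ k, hh i m (X k ω) - a i m * ∑ k, hh i m (Y k ω) =
      ε * (|D i m| - if m ∈ T i then |D i m| else 0) := by
    intro m hm
    rw [← mul_sub]
    change a i m * D i m = _
    rw [haz i m hm]
    split_ifs
    · ring
    · rw [hzD]; ring
  rw [Finset.sum_congr rfl e1, ← Finset.mul_sum]
  apply mul_le_mul_of_nonneg_left _ hε
  rw [Finset.sum_sub_distrib, Finset.sum_sub_distrib, ← Finset.sum_filter, Finset.filter_mem_eq_inter,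
    Finset.inter_eq_right.2 (hTs i)]
  have h1 : ∑ m ∈ T i, |D i m| ≤ ∑ m ∈ T i, (τ i + D i m ^ 2 / (4 * τ i)) := by
    refine Finset.sum_le_sum fun m _ => ?_
    have ht := hτ i
    rw [← sub_nonneg, ← sq_abs]
    have : τ i + |D i m| ^ 2 / (4 * τ i) - |D i m| = (2 * τ i - |D i m|) ^ 2 / (4 * τ i) := by field_simp; ring
    rw [this]; positivity
  rw [Finset.sum_add_distrib, Finset.sum_const, nsmul_eq_mul] at h1
  have h2 : ∑ m ∈ T i, D i m ^ 2 / (4 * τ i) ≤ ∑ m ∈ cells i, D i m ^ 2 / (4 * τ i) :=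
    Finset.sum_le_sum_of_subset_of_nonneg (hTs i) fun m _ _ => by have := hτ i; positivity
  have h3 : ((T i).card : ℝ) ≤ 6 * 4 ^ i / (M - 1) ^ 2 := by
    rw [le_div_iff₀ (by have : 0 < M - 1 := by linarith
                        positivity)]
    exact hcard i (Finset.mem_range.1 hi)
  have h4 := mul_le_mul_of_nonneg_right h3 (hτ i).le
  change ∑ m ∈ cells i, |D i m| - ∑ m ∈ cells i, D i m ^ 2 / (4 * τ i) - _ ≤ _
  linarith

def kk : ℝ := 1 / 630 ^ 2 - 1 / 30 ^ 4
def c1 : ℝ := 1 - Real.exp (-(4 / π ^ 2 * kk))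
lemma c1_pos : 0 < c1 := by
  unfold c1
  have hk : 0 < kk := by unfold kk; norm_num
  have : 0 < 4 / π ^ 2 * kk := by positivity
  have h := Real.exp_lt_exp.2 (by linarith : -(4 / π ^ 2 * kk) < 0)
  rw [Real.exp_zero] at h
  linarith

lemma Samp.D_lower (S : Samp P X Y) {i : ℕ} (hi : 4 ^ i ≤ n) {m : ℕ × ℕ} (hm : m ∈ cells i) :
    √n / 4 ^ i * c1 ≤ ∫ ω, |Dsum X Y (hh i m) ω| ∂P := by
  have hn : 0 < n := lt_of_lt_of_le (by positivity) hi
  have hn' : (0:ℝ) < n := by exact_mod_cast hn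
  have e4 : (4:ℝ) ^ i = 2 ^ i * 2 ^ i := by rw [← mul_pow]; norm_num
  have h2n : (2:ℝ) ^ i ≤ √n := by
    apply Real.le_sqrt_of_sq_le
    rw [sq, ← e4]; exact_mod_cast hi
  refine S.abs_lower (hh_meas i m) (s := √n / 4 ^ i) (κ := kk) (by positivity) (fun x => (hh_abs i m x).trans ?_) hn ?_
  · rw [e4, le_div_iff₀ (by positivity)]
    have : ((2:ℝ) ^ i)⁻¹ * (2 ^ i * 2 ^ i) = 2 ^ i := by field_simp
    rw [this]; exact h2n
  · rw [hh_int hm, hh2_int hm, div_pow, Real.sq_sqrt hn'.le]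
    have e : kk * (n / ((4:ℝ) ^ i) ^ 2) / n = kk * (((4:ℝ) ^ i)⁻¹ * ((4:ℝ) ^ i)⁻¹) := by field_simp
    rw [e]
    set q := ((4:ℝ) ^ i)⁻¹ with hq
    have hq0 : 0 < q := by positivity
    have hp0 : 0 < ((2:ℝ) ^ i)⁻¹ := by positivity
    have hp1 : ((2:ℝ) ^ i)⁻¹ ≤ 1 := inv_le_one_of_one_le₀ (one_le_pow₀ (by norm_num))
    have : ((2:ℝ) ^ i)⁻¹ ^ 2 ≤ 1 := pow_le_one₀ hp0.le hp1
    have h5 := mul_le_mul_of_nonneg_right this (by positivity : 0 ≤ q * q * (1 / 30 ^ 4))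
    unfold kk
    nlinarith

lemma Samp.D_upper (S : Samp P X Y) {i : ℕ} (hn : 0 < n) {m : ℕ × ℕ} (hm : m ∈ cells i) :
    ∫ ω, Dsum X Y (hh i m) ω ^ 2 ∂P ≤ 2 * (√n / 4 ^ i) ^ 2 := by
  have hn' : (0:ℝ) < n := by exact_mod_cast hn
  refine (S.second_moment (hh_meas i m) (hh_abs i m)).trans ?_
  rw [hh2_int hm, div_pow, Real.sq_sqrt hn'.le]
  have e : 2 * (n / ((4:ℝ) ^ i) ^ 2) = 2 * n * (((4:ℝ) ^ i)⁻¹ * ((4:ℝ) ^ i)⁻¹) := by field_simp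
  rw [e]
  apply mul_le_mul_of_nonneg_left _ (by positivity)
  have : 0 < ((4:ℝ) ^ i)⁻¹ * ((4:ℝ) ^ i)⁻¹ := by positivity
  nlinarith

def MM : ℝ := 1 + 5 / c1
def cc : ℝ := c1 / (16 * (MM + 2))
lemma MM_gt : 1 < MM := by
  unfold MM; have := c1_pos
  have : 0 < 5 / c1 := by positivity
  linarith
lemma cc_pos : 0 < cc := by
  have := c1_pos; have := MM_gt
  unfold cc; positivity

lemma Samp.lower_r (S : Samp P X Y) (hn : 0 < n) (r : ℕ) (hr0 : 0 < r) (hr : ∀ i < r, 4 ^ i ≤ n) :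
    c1 / 4 * √(r * n) ≤ 2 * (MM + 2) * (n * ∫ ω, matchingCost (fun k => X k ω) (fun k => Y k ω) ∂P) := by
  have := S.prob
  have hn' : (0:ℝ) < n := by exact_mod_cast hn
  have hr' : (1:ℝ) ≤ r := by exact_mod_cast hr0
  have hc := c1_pos
  let ε : ℝ := (√r)⁻¹
  have hsr : 1 ≤ √(r:ℝ) := Real.one_le_sqrt.2 hr'
  have hε : 0 ≤ ε := by positivity
  have hε1 : ε ≤ 1 := inv_le_one_of_one_le₀ hsr
  have hrε : r * ε ^ 2 ≤ 1 := by
    simp only [ε]; rw [inv_pow, Real.sq_sqrt (by positivity)]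
    exact le_of_eq (mul_inv_cancel₀ (by positivity))
  let s : ℕ → ℝ := fun i => √n / 4 ^ i
  have hs : ∀ i, 0 < s i := fun i => by positivity
  let τ : ℕ → ℝ := fun i => s i / c1
  have hτ : ∀ i, 0 < τ i := fun i => div_pos (hs i) hc
  have i1 : ∀ i m, Integrable (fun ω => |Dsum X Y (hh i m) ω|) P := fun i m =>
    ((S.D_memLp (hh_meas i m) (hh_abs i m) 1).integrable le_rfl).abs
  have i2 : ∀ i m, Integrable (fun ω => Dsum X Y (hh i m) ω ^ 2 / (4 * τ i)) P := fun i m =>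
    (S.D_memLp (hh_meas i m) (hh_abs i m) 2).integrable_sq.div_const _
  have i3 : ∀ i m, Integrable (fun ω => |Dsum X Y (hh i m) ω| - Dsum X Y (hh i m) ω ^ 2 / (4 * τ i)) P :=
    fun i m => (i1 i m).sub (i2 i m)
  have i4 : ∀ i, Integrable (fun ω => ∑ m ∈ cells i, (|Dsum X Y (hh i m) ω| - Dsum X Y (hh i m) ω ^ 2 / (4 * τ i))) P :=
    fun i => integrable_finsetSum _ fun m _ => i3 i m
  have i5 : ∀ i, Integrable (fun ω => ∑ m ∈ cells i, (|Dsum X Y (hh i m) ω| - Dsum X Y (hh i m) ω ^ 2 / (4 * τ i))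
      - τ i * (6 * 4 ^ i / (MM - 1) ^ 2)) P := fun i => (i4 i).sub (integrable_const _)
  have hmain := integral_mono ((integrable_finsetSum (Finset.range r) fun i _ => i5 i).const_mul ε)
    ((S.integrable_mc.const_mul (n:ℝ)).const_mul (2 * (MM + 2)))
    (fun ω => lower_pt hn hε hε1 MM_gt r hrε τ hτ ω)
  rw [integral_const_mul, integral_const_mul, integral_const_mul, integral_finsetSum _ fun i _ => i5 i] at hmain
  refine le_trans ?_ hmain
  have hlev : ∀ i ∈ Finset.range r, c1 / 4 * √n ≤
      ∫ ω, (∑ m ∈ cells i, (|Dsum X Y (hh i m) ω| - Dsum X Y (hh i m) ω ^ 2 / (4 * τ i))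
      - τ i * (6 * 4 ^ i / (MM - 1) ^ 2)) ∂P := by
    intro i hi
    have hi' := hr i (Finset.mem_range.1 hi)
    rw [integral_sub (i4 i) (integrable_const _), integral_finsetSum _ fun m _ => i3 i m, integral_const,
      probReal_univ, one_smul]
    have hcell : ∀ m ∈ cells i, s i * c1 / 2 ≤
        ∫ ω, (|Dsum X Y (hh i m) ω| - Dsum X Y (hh i m) ω ^ 2 / (4 * τ i)) ∂P := by
      intro m hm
      rw [integral_sub (i1 i m) (i2 i m), integral_div]
      have a1 := S.D_lower hi' hm
      have a2 := S.D_upper hn hm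
      change s i * c1 ≤ _ at a1
      change _ ≤ 2 * (s i) ^ 2 at a2
      have a3 : (∫ ω, Dsum X Y (hh i m) ω ^ 2 ∂P) / (4 * τ i) ≤ 2 * (s i) ^ 2 / (4 * τ i) := by
        have := hτ i
        gcongr
      have a4 : 2 * (s i) ^ 2 / (4 * τ i) = s i * c1 / 2 := by
        have := (hs i).ne'
        simp only [τ]; field_simp; ring
      linarith
    have hsum := Finset.sum_le_sum hcell
    rw [Finset.sum_const, nsmul_eq_mul, card_cells] at hsum
    have e1 : (4:ℝ) ^ i * (s i * c1 / 2) = c1 / 2 * √n := by simp only [s]; field_simp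
    have e2 : τ i * (6 * 4 ^ i / (MM - 1) ^ 2) = 6 / 25 * c1 * √n := by
      simp only [τ, s, MM]; field_simp; ring
    rw [e2]
    have : 0 < c1 * √n := by positivity
    linarith
  have hfin := Finset.sum_le_sum hlev
  rw [Finset.sum_const, Finset.card_range, nsmul_eq_mul] at hfin
  have h9 := mul_le_mul_of_nonneg_left hfin hε
  refine le_trans (le_of_eq ?_) h9
  rw [Real.sqrt_mul (by positivity)]
  have : (r:ℝ) = √r * √r := (Real.mul_self_sqrt (by positivity)).symm
  simp only [ε]
  nth_rewrite 3 [this]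
  have : √(r:ℝ) ≠ 0 := by positivity
  field_simp

lemma Samp.lower (S : Samp P X Y) (hn : 2 ≤ n) :
    cc * √(Real.log n / n) ≤ ∫ ω, matchingCost (fun k => X k ω) (fun k => Y k ω) ∂P := by
  have hn0 : (0:ℝ) < n := by positivity
  have hn2 : (2:ℝ) ≤ n := by exact_mod_cast hn
  have h := S.lower_r (by omega) (Nat.log 4 n + 1) (by omega) (fun i hi =>
    (Nat.pow_le_pow_right (by norm_num) (by omega)).trans (Nat.pow_log_le_self 4 (by omega)))
  set r := Nat.log 4 n + 1 with hr
  have h4 : (n:ℝ) ≤ 4 ^ r := by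
    exact_mod_cast (Nat.lt_pow_succ_log_self (by norm_num) n).le
  have hlog : Real.log n ≤ r * Real.log 4 := by
    rw [← Real.log_pow]; exact Real.log_le_log hn0 h4
  have hl4 : Real.log 4 ≤ 2 := by
    rw [show (4:ℝ) = 2 ^ 2 by norm_num, Real.log_pow]
    have := Real.log_two_lt_d9; push_cast; linarith
  have hr0 : (0:ℝ) ≤ r := by positivity
  have hrl : Real.log n ≤ 4 * r := by nlinarith
  have hlogpos : 0 < Real.log n := Real.log_pos (by linarith)
  have hs : √(n * Real.log n) ≤ 2 * √(r * n) := by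
    rw [show (2:ℝ) = √(2 ^ 2) by rw [Real.sqrt_sq (by norm_num)], ← Real.sqrt_mul (by positivity)]
    apply Real.sqrt_le_sqrt
    nlinarith
  have e : √(Real.log n / n) = √(n * Real.log n) / n := by
    rw [show Real.log n / n = (n * Real.log n) / n ^ 2 by field_simp, Real.sqrt_div (by positivity), Real.sqrt_sq hn0.le]
  have hc := c1_pos
  have hM := MM_gt
  rw [e, mul_div_assoc', div_le_iff₀ hn0]
  unfold cc
  rw [div_mul_eq_mul_div, div_le_iff₀ (by linarith)]
  have := mul_le_mul_of_nonneg_left hs hc.le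
  linarith
end

/-- The Ajtai–Komlós–Tusnády optimal matching theorem (in expectation). -/
theorem AKT_optimal_matching :
    ∃ c C : ℝ, 0 < c ∧ 0 < C ∧
      ∀ (n : ℕ), 2 ≤ n →
      ∀ (Ω : Type) (_ : MeasurableSpace Ω) (P : Measure Ω), IsProbabilityMeasure P →
      ∀ (X Y : Fin n → Ω → (Fin 2 → ℝ)),
        iIndepFun (Sum.elim X Y) P →
        (∀ k, P.map (X k) = uniformSquare) →
        (∀ k, P.map (Y k) = uniformSquare) →
        c * Real.sqrt (Real.log n / n)
            ≤ ∫ ω, matchingCost (fun k => X k ω) (fun k => Y k ω) ∂P ∧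
        ∫ ω, matchingCost (fun k => X k ω) (fun k => Y k ω) ∂P
            ≤ C * Real.sqrt (Real.log n / n) := by
  refine ⟨cc, 120, cc_pos, by norm_num, ?_⟩
  intro n hn Ω _ P hP X Y hind hX hY
  have S : Samp P X Y := ⟨hP, hind, hX, hY⟩
  exact ⟨S.lower hn, S.upper hn⟩
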